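/- Let 1 ≤ p < ∞, m, m₁, m₂ ∈ ℕ₀, a₁, a₂ ∈ ℝ and 0 ≤ ℓ < d. If either 1 < p < ∞ and min(m₁,m₂) ≥ m > d/p, or p = 1 and min(m₁,m₂) ≥ m ≥ d, then there exists a constant c such that ‖u·v | 𝒦^m_{a₁+a₂−d/p, p}(ℝ^d,ℝ^ℓ_*)‖ ≤ c ‖u | 𝒦^{m₁}_{a₁,p}(ℝ^d,ℝ^ℓ_*)‖ · ‖v | 𝒦^{m₂}_{a₂,p}(ℝ^d,ℝ^ℓ_*)‖ holds for all u ∈ 𝒦^{m₁}_{a₁,p}(ℝ^d,ℝ^ℓ_*) and v ∈ 𝒦^{m₂}_{a₂,p}(ℝ^d,ℝ^ℓ_*). -/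

import Mathlib

open MeasureTheory Metric Set Filter
open scoped Topology ENNReal NNReal

noncomputable section

/-- `d`-dimensional Euclidean space. -/
abbrev Ed (d : ℕ) : Type := EuclideanSpace ℝ (Fin d)

/-- The finite set of all multi-indices `α : Fin d → ℕ` with `|α| = ∑ i, α i ≤ m`. -/
def multiIdx (d m : ℕ) : Finset (Fin d → ℕ) :=
  (Fintype.piFinset fun _ : Fin d => Finset.range (m + 1)).filter fun α => ∑ i, α i ≤ m

/-- First-order partial derivative in the `i`-th coordinate direction. -/
def pderivI (d : ℕ) (i : Fin d) (f : Ed d → ℝ) : Ed d → ℝ :=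
  fun x => fderiv ℝ f x (EuclideanSpace.single i 1)

/-- Iterated partial derivative `∂^α`. -/
def pderivA (d : ℕ) (α : Fin d → ℕ) (f : Ed d → ℝ) : Ed d → ℝ :=
  ((List.finRange d).foldr (fun i g => (pderivI d i)^[α i] ∘ g) id) f

/-- Smooth compactly supported test functions with support inside `Ω`. -/
def IsTestFun (d : ℕ) (Ω : Set (Ed d)) (φ : Ed d → ℝ) : Prop :=
  ContDiff ℝ (⊤ : ℕ∞) φ ∧ HasCompactSupport φ ∧ tsupport φ ⊆ Ω

/-- `v` is the `α`-th weak (distributional) derivative of `u` on `Ω`. -/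
def HasWeakDerivOn (d : ℕ) (Ω : Set (Ed d)) (α : Fin d → ℕ) (u v : Ed d → ℝ) : Prop :=
  LocallyIntegrableOn u Ω volume ∧ LocallyIntegrableOn v Ω volume ∧
    ∀ φ : Ed d → ℝ, IsTestFun d Ω φ →
      ∫ x in Ω, u x * pderivA d α φ x = (-1 : ℝ) ^ (∑ i, α i) * ∫ x in Ω, v x * φ x

/-- `D` is a family of weak derivatives of `u` on `Ω` for all multi-indices of order `≤ m`. -/
def IsWeakDerivFamily (d : ℕ) (Ω : Set (Ed d)) (m : ℕ) (u : Ed d → ℝ)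
    (D : (Fin d → ℕ) → Ed d → ℝ) : Prop :=
  ∀ α ∈ multiIdx d m, HasWeakDerivOn d Ω α u (D α)

/-- `x ↦ (ρ(x)^(|α|-a) |v(x)|)^p`, the integrand in the Kondratiev norm. -/
def kIntegrand (d : ℕ) (ρ : Ed d → ℝ) (a p : ℝ) (α : Fin d → ℕ) (v : Ed d → ℝ) : Ed d → ℝ :=
  fun x => (ρ x ^ (((∑ i, α i : ℕ) : ℝ) - a) * |v x|) ^ p

/-- The Kondratiev norm computed from a family `D` of weak derivatives. -/
def KnormP (d : ℕ) (Ω : Set (Ed d)) (ρ : Ed d → ℝ) (m : ℕ) (a p : ℝ)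
    (D : (Fin d → ℕ) → Ed d → ℝ) : ℝ :=
  (∑ α ∈ multiIdx d m, ∫ x in Ω, kIntegrand d ρ a p α (D α) x) ^ (1 / p)

/-- `D` witnesses membership of `u` in the Kondratiev space `𝒦^m_{a,p}(Ω, M)`
    (with weight function `ρ`). -/
def KMemData (d : ℕ) (Ω : Set (Ed d)) (ρ : Ed d → ℝ) (m : ℕ) (a p : ℝ)
    (u : Ed d → ℝ) (D : (Fin d → ℕ) → Ed d → ℝ) : Prop :=
  IsWeakDerivFamily d Ω m u D ∧
    ∀ α ∈ multiIdx d m, IntegrableOn (kIntegrand d ρ a p α (D α)) Ω volume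

/-- Membership in the Kondratiev space `𝒦^m_{a,p}(Ω, M)` with weight `ρ`, `p < ∞`. -/
def MemK (d : ℕ) (Ω : Set (Ed d)) (ρ : Ed d → ℝ) (m : ℕ) (a p : ℝ) (u : Ed d → ℝ) : Prop :=
  ∃ D, KMemData d Ω ρ m a p u D

open Classical in
/-- The Kondratiev norm of `u` (computed from a choice of weak derivative family;
    it is a.e. independent of this choice). -/
def Knorm (d : ℕ) (Ω : Set (Ed d)) (ρ : Ed d → ℝ) (m : ℕ) (a p : ℝ) (u : Ed d → ℝ) : ℝ :=
  if h : MemK d Ω ρ m a p u then KnormP d Ω ρ m a p h.choose else 0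

/-- `x ↦ ρ(x)^(|α|-a) v(x)`, the function whose `L_∞` norm enters the norm for `p = ∞`. -/
def kIntegrandInf (d : ℕ) (ρ : Ed d → ℝ) (a : ℝ) (α : Fin d → ℕ) (v : Ed d → ℝ) : Ed d → ℝ :=
  fun x => ρ x ^ (((∑ i, α i : ℕ) : ℝ) - a) * v x

/-- `D` witnesses membership of `u` in `𝒦^m_{a,∞}(Ω, M)`. -/
def KMemDataInf (d : ℕ) (Ω : Set (Ed d)) (ρ : Ed d → ℝ) (m : ℕ) (a : ℝ)
    (u : Ed d → ℝ) (D : (Fin d → ℕ) → Ed d → ℝ) : Prop :=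
  IsWeakDerivFamily d Ω m u D ∧
    ∀ α ∈ multiIdx d m,
      eLpNorm (kIntegrandInf d ρ a α (D α)) ⊤ (volume.restrict Ω) < ⊤

/-- Membership in `𝒦^m_{a,∞}(Ω, M)`. -/
def MemKInf (d : ℕ) (Ω : Set (Ed d)) (ρ : Ed d → ℝ) (m : ℕ) (a : ℝ) (u : Ed d → ℝ) : Prop :=
  ∃ D, KMemDataInf d Ω ρ m a u D

/-- The `𝒦^m_{a,∞}` norm computed from a family `D` of weak derivatives. -/
def KnormInfP (d : ℕ) (Ω : Set (Ed d)) (ρ : Ed d → ℝ) (m : ℕ) (a : ℝ)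
    (D : (Fin d → ℕ) → Ed d → ℝ) : ℝ :=
  ∑ α ∈ multiIdx d m, (eLpNorm (kIntegrandInf d ρ a α (D α)) ⊤ (volume.restrict Ω)).toReal

open Classical in
/-- The `𝒦^m_{a,∞}(Ω, M)` norm of `u`. -/
def KnormInf (d : ℕ) (Ω : Set (Ed d)) (ρ : Ed d → ℝ) (m : ℕ) (a : ℝ) (u : Ed d → ℝ) : ℝ :=
  if h : MemKInf d Ω ρ m a u then KnormInfP d Ω ρ m a h.choose else 0

/-- The subspace `ℝ^ℓ_* = {x : x₁ = ⋯ = x_{d-ℓ} = 0}` of `ℝ^d`. -/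
def RStar (d ℓ : ℕ) : Set (Ed d) := {x | ∀ i : Fin d, (i : ℕ) < d - ℓ → x i = 0}

/-- The weight `ρ(x) = min(1, |x'|)` for the model case `(ℝ^d, ℝ^ℓ_*)`. -/
def rhoModel (d ℓ : ℕ) (x : Ed d) : ℝ :=
  min 1 (Real.sqrt (∑ i ∈ Finset.univ.filter (fun i : Fin d => (i : ℕ) < d - ℓ), (x i) ^ 2))

/-- The model domain `ℝ^d ∖ ℝ^ℓ_*`. -/
def ModelDomain (d ℓ : ℕ) : Set (Ed d) := (RStar d ℓ)ᶜ

/-- Membership in the model Kondratiev space `𝒦^m_{a,p}(ℝ^d, ℝ^ℓ_*)`, `p < ∞`. -/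
def MemKM (d ℓ m : ℕ) (a p : ℝ) (u : Ed d → ℝ) : Prop :=
  MemK d (ModelDomain d ℓ) (rhoModel d ℓ) m a p u

/-- The norm of the model Kondratiev space `𝒦^m_{a,p}(ℝ^d, ℝ^ℓ_*)`, `p < ∞`. -/
def KnormM (d ℓ m : ℕ) (a p : ℝ) (u : Ed d → ℝ) : ℝ :=
  Knorm d (ModelDomain d ℓ) (rhoModel d ℓ) m a p u

/-- Membership in the model Kondratiev space `𝒦^m_{a,∞}(ℝ^d, ℝ^ℓ_*)`. -/
def MemKMInf (d ℓ m : ℕ) (a : ℝ) (u : Ed d → ℝ) : Prop :=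
  MemKInf d (ModelDomain d ℓ) (rhoModel d ℓ) m a u

/-- The norm of the model Kondratiev space `𝒦^m_{a,∞}(ℝ^d, ℝ^ℓ_*)`. -/
def KnormMInf (d ℓ m : ℕ) (a : ℝ) (u : Ed d → ℝ) : ℝ :=
  KnormInf d (ModelDomain d ℓ) (rhoModel d ℓ) m a u

/-- Smooth real functions on `ℝ^d`. -/
abbrev Smo {d : ℕ} (f : Ed d → ℝ) : Prop := ContDiff ℝ (⊤ : ℕ∞) f

/-- The order of a multi-index. -/
abbrev ord {d : ℕ} (α : Fin d → ℕ) : ℕ := ∑ i, α i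

section Calc
variable {d : ℕ}

lemma Smo.diff {f : Ed d → ℝ} (hf : Smo f) : Differentiable ℝ f :=
  ContDiff.differentiable hf (by simp)

lemma Smo.cont {f : Ed d → ℝ} (hf : Smo f) : Continuous f :=
  ContDiff.continuous hf

lemma Smo.pderivI {f : Ed d → ℝ} (hf : Smo f) (i : Fin d) : Smo (pderivI d i f) := by
  have h : ContDiff ℝ (⊤ : ℕ∞) (fderiv ℝ f) := ContDiff.fderiv_right hf (by simp)
  exact h.clm_apply contDiff_const

lemma Smo.iter {f : Ed d → ℝ} (hf : Smo f) (i : Fin d) (n : ℕ) : Smo ((_root_.pderivI d i)^[n] f) := by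
  induction n with
  | zero => exact hf
  | succ n ih => rw [Function.iterate_succ_apply']; exact ih.pderivI i

lemma pderivI_comm {f : Ed d → ℝ} (hf : Smo f) (i j : Fin d) :
    pderivI d i (pderivI d j f) = pderivI d j (pderivI d i f) := by
  have h : ContDiff ℝ (⊤ : ℕ∞) (fderiv ℝ f) := ContDiff.fderiv_right hf (by simp)
  have hd : Differentiable ℝ (fderiv ℝ f) := h.differentiable (by simp)
  funext x
  have key : ∀ v w : Ed d, fderiv ℝ (fun y => fderiv ℝ f y v) x w = fderiv ℝ (fderiv ℝ f) x w v := by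
    intro v w
    rw [fderiv_clm_apply (hd x) (differentiableAt_const v)]
    simp
  unfold pderivI
  rw [key, key]
  have hs : IsSymmSndFDerivAt ℝ f x := by
    apply ContDiffAt.isSymmSndFDerivAt (n := (⊤ : ℕ∞)) (ContDiff.contDiffAt hf)
    simp only [minSmoothness_of_isRCLikeNormedField]
    exact WithTop.coe_le_coe.mpr (le_top : (2 : ℕ∞) ≤ ⊤)
  exact hs _ _

lemma pderivI_iter_comm {f : Ed d → ℝ} (hf : Smo f) (i j : Fin d) (n : ℕ) :
    pderivI d i ((pderivI d j)^[n] f) = (pderivI d j)^[n] (pderivI d i f) := by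
  induction n with
  | zero => rfl
  | succ n ih =>
    rw [Function.iterate_succ_apply', Function.iterate_succ_apply', pderivI_comm (hf.iter j n), ih]

/-- auxiliary: iterated derivative along a list of coordinates -/
def PL (l : List (Fin d)) (α : Fin d → ℕ) (f : Ed d → ℝ) : Ed d → ℝ :=
  (l.foldr (fun i g => (pderivI d i)^[α i] ∘ g) id) f

lemma PL_cons (j : Fin d) (l : List (Fin d)) (α : Fin d → ℕ) (f : Ed d → ℝ) :
    PL (j :: l) α f = (pderivI d j)^[α j] (PL l α f) := rfl

lemma PL_smo (l : List (Fin d)) (α : Fin d → ℕ) {f : Ed d → ℝ} (hf : Smo f) : Smo (PL l α f) := by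
  induction l with
  | nil => exact hf
  | cons j l ih => rw [PL_cons]; exact ih.iter _ _

lemma PL_notMem (l : List (Fin d)) (α : Fin d → ℕ) (f : Ed d → ℝ) (i : Fin d) (hi : i ∉ l) :
    PL l (α + Pi.single i 1) f = PL l α f := by
  induction l with
  | nil => rfl
  | cons j l ih =>
    simp only [List.mem_cons, not_or] at hi
    rw [PL_cons, PL_cons, ih hi.2]
    simp [Pi.single_eq_of_ne (Ne.symm hi.1)]

lemma PL_mem (l : List (Fin d)) (hl : l.Nodup) (α : Fin d → ℕ) {f : Ed d → ℝ} (hf : Smo f)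
    (i : Fin d) (hi : i ∈ l) :
    PL l (α + Pi.single i 1) f = pderivI d i (PL l α f) := by
  induction l with
  | nil => simp at hi
  | cons j l ih =>
    rw [List.nodup_cons] at hl
    rw [PL_cons, PL_cons]
    by_cases hij : i = j
    · subst hij
      rw [PL_notMem l α f i hl.1]
      simp only [Pi.add_apply, Pi.single_eq_same]
      rw [Function.iterate_succ_apply']
    · have : i ∈ l := by simpa [hij] using hi
      rw [ih hl.2 this, pderivI_iter_comm (PL_smo l α hf)]
      simp [Pi.single_eq_of_ne (Ne.symm hij)]

lemma Smo.pderivA {f : Ed d → ℝ} (hf : Smo f) (α : Fin d → ℕ) : Smo (pderivA d α f) :=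
  PL_smo _ _ hf

lemma pderivA_zero (f : Ed d → ℝ) : pderivA d 0 f = f := by
  have : ∀ l : List (Fin d), PL l 0 f = f := by
    intro l
    induction l with
    | nil => rfl
    | cons j l ih => rw [PL_cons, ih]; rfl
  exact this _

lemma pderivA_succ {f : Ed d → ℝ} (hf : Smo f) (α : Fin d → ℕ) (i : Fin d) :
    pderivA d (α + Pi.single i 1) f = pderivI d i (pderivA d α f) :=
  PL_mem _ (List.nodup_finRange d) α hf i (List.mem_finRange i)

lemma ord_add (α β : Fin d → ℕ) : ord (α + β) = ord α + ord β := by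
  simp [ord, Finset.sum_add_distrib]

lemma ord_single (i : Fin d) : ord (Pi.single i 1 : Fin d → ℕ) = 1 := by
  simp [ord]

lemma ord_zero : ord (0 : Fin d → ℕ) = 0 := by simp [ord]

lemma eq_zero_of_ord {α : Fin d → ℕ} (h : ord α = 0) : α = 0 := by
  funext i
  simpa using (Finset.sum_eq_zero_iff.mp h) i (Finset.mem_univ i)

/-- Induction on multi-indices. -/
lemma mi_induction {P : (Fin d → ℕ) → Prop} (h0 : P 0)
    (hs : ∀ α i, P α → P (α + Pi.single i 1)) (α : Fin d → ℕ) : P α := by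
  generalize hn : ord α = n
  induction n generalizing α with
  | zero => rw [eq_zero_of_ord hn]; exact h0
  | succ n ih =>
    have : ∃ i, α i ≠ 0 := by
      by_contra hc
      push Not at hc
      have : ord α = 0 := Finset.sum_eq_zero (fun i _ => hc i)
      omega
    obtain ⟨i, hi⟩ := this
    have he : α = (α - Pi.single i 1) + Pi.single i 1 := by
      funext j
      by_cases hj : j = i
      · subst hj; simp; omega
      · simp [Pi.single_eq_of_ne hj]
    rw [he]
    apply hs
    apply ih
    have h2 := hn
    rw [he, ord_add, ord_single] at h2
    omega

lemma mem_multiIdx {m : ℕ} {α : Fin d → ℕ} : α ∈ multiIdx d m ↔ ord α ≤ m := by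
  unfold multiIdx
  simp only [Finset.mem_filter, Fintype.mem_piFinset, Finset.mem_range, and_iff_right_iff_imp]
  intro h i
  change ord α ≤ m at h
  have : α i ≤ ord α := Finset.single_le_sum (f := α) (fun _ _ => Nat.zero_le _) (Finset.mem_univ i)
  omega

lemma multiIdx_mono {m n : ℕ} (h : m ≤ n) : multiIdx d m ⊆ multiIdx d n := by
  intro α hα
  rw [mem_multiIdx] at *
  omega

lemma pderivI_add {f g : Ed d → ℝ} (hf : Smo f) (hg : Smo g) (i : Fin d) :
    pderivI d i (f + g) = pderivI d i f + pderivI d i g := by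
  funext x
  simp [pderivI, fderiv_add (hf.diff x) (hg.diff x)]

lemma pderivI_sub {f g : Ed d → ℝ} (hf : Smo f) (hg : Smo g) (i : Fin d) :
    pderivI d i (f - g) = pderivI d i f - pderivI d i g := by
  funext x
  simp [pderivI, fderiv_sub (hf.diff x) (hg.diff x)]

lemma pderivI_smul {f : Ed d → ℝ} (hf : Smo f) (c : ℝ) (i : Fin d) :
    pderivI d i (c • f) = c • pderivI d i f := by
  funext x
  simp [pderivI, fderiv_const_smul (hf.diff x)]

lemma pderivI_mul {f g : Ed d → ℝ} (hf : Smo f) (hg : Smo g) (i : Fin d) :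
    pderivI d i (f * g) = pderivI d i f * g + f * pderivI d i g := by
  funext x
  simp [pderivI, fderiv_mul (hf.diff x) (hg.diff x)]
  ring

lemma pderivI_sum {ι : Type*} (s : Finset ι) (F : ι → Ed d → ℝ) (hF : ∀ j ∈ s, Smo (F j)) (i : Fin d) :
    pderivI d i (∑ j ∈ s, F j) = ∑ j ∈ s, pderivI d i (F j) := by
  funext x
  simp only [pderivI, Finset.sum_apply]
  rw [fderiv_sum (fun j hj => (hF j hj).diff x)]
  simp

lemma pderivA_sub {f g : Ed d → ℝ} (hf : Smo f) (hg : Smo g) (α : Fin d → ℕ) :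
    pderivA d α (f - g) = pderivA d α f - pderivA d α g := by
  induction α using mi_induction with
  | h0 => simp [pderivA_zero]
  | hs α i ih =>
    have hfg : Smo (f - g) := ContDiff.sub hf hg
    rw [pderivA_succ hfg, pderivA_succ hf, pderivA_succ hg, ih, pderivI_sub (hf.pderivA α) (hg.pderivA α)]

/-- Pairs of multi-indices with sum `α`. -/
def splits (α : Fin d → ℕ) : Finset ((Fin d → ℕ) × (Fin d → ℕ)) :=
  (multiIdx d (ord α) ×ˢ multiIdx d (ord α)).filter fun q => q.1 + q.2 = α

lemma mem_splits {α : Fin d → ℕ} {q : (Fin d → ℕ) × (Fin d → ℕ)} :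
    q ∈ splits α ↔ q.1 + q.2 = α := by
  unfold splits
  simp only [Finset.mem_filter, Finset.mem_product, mem_multiIdx, and_iff_right_iff_imp]
  intro h
  rw [← h, ord_add]
  omega

/-- Leibniz coefficient (existence form). -/
lemma leibniz_exists (α : Fin d → ℕ) : ∃ c : (Fin d → ℕ) × (Fin d → ℕ) → ℝ,
    ∀ f g : Ed d → ℝ, Smo f → Smo g →
      pderivA d α (f * g) = ∑ q ∈ splits α, c q • (pderivA d q.1 f * pderivA d q.2 g) := by
  induction α using mi_induction with
  | h0 =>
    refine ⟨fun _ => 1, fun f g _ _ => ?_⟩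
    have : splits (0 : Fin d → ℕ) = {(0, 0)} := by
      ext ⟨a, b⟩
      simp [mem_splits, Prod.ext_iff]
    simp [this, pderivA_zero]
  | hs α i ih =>
    obtain ⟨c, hc⟩ := ih
    classical
    refine ⟨fun q => (∑ r ∈ splits α, if (r.1 + Pi.single i 1, r.2) = q then c r else 0) +
      (∑ r ∈ splits α, if (r.1, r.2 + Pi.single i 1) = q then c r else 0), fun f g hf hg => ?_⟩
    have hfg : Smo (f * g) := ContDiff.mul hf hg
    rw [pderivA_succ hfg, hc f g hf hg]
    have hsm : ∀ q : (Fin d → ℕ) × (Fin d → ℕ), Smo (pderivA d q.1 f * pderivA d q.2 g) :=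
      fun q => ContDiff.mul (hf.pderivA _) (hg.pderivA _)
    rw [pderivI_sum (splits α) (fun q => c q • (pderivA d q.1 f * pderivA d q.2 g))
      (fun q _ => ContDiff.const_smul (c q) (hsm q))]
    have h1 : ∀ q ∈ splits α, pderivI d i (c q • (pderivA d q.1 f * pderivA d q.2 g))
        = c q • (pderivA d (q.1 + Pi.single i 1) f * pderivA d q.2 g) +
          c q • (pderivA d q.1 f * pderivA d (q.2 + Pi.single i 1) g) := by
      intro q _
      rw [pderivI_smul (hsm q), pderivI_mul (hf.pderivA _) (hg.pderivA _), pderivA_succ hf,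
        pderivA_succ hg, smul_add]
    rw [Finset.sum_congr rfl h1, Finset.sum_add_distrib]
    simp only [add_smul, Finset.sum_add_distrib, Finset.sum_smul]
    congr 1
    · rw [Finset.sum_comm]
      refine Finset.sum_congr rfl fun r hr => ?_
      rw [Finset.sum_eq_single (r.1 + Pi.single i 1, r.2)]
      · simp
      · intro b _ hb; simp [Ne.symm hb]
      · intro hn
        exfalso; apply hn
        rw [mem_splits] at hr ⊢
        rw [← hr]; simp only; abel
    · rw [Finset.sum_comm]
      refine Finset.sum_congr rfl fun r hr => ?_
      rw [Finset.sum_eq_single (r.1, r.2 + Pi.single i 1)]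
      · simp
      · intro b _ hb; simp [Ne.symm hb]
      · intro hn
        exfalso; apply hn
        rw [mem_splits] at hr ⊢
        rw [← hr]; simp only; abel

/-- Leibniz coefficients. -/
def lc (α : Fin d → ℕ) : (Fin d → ℕ) × (Fin d → ℕ) → ℝ := (leibniz_exists α).choose

lemma leibniz (α : Fin d → ℕ) {f g : Ed d → ℝ} (hf : Smo f) (hg : Smo g) :
    pderivA d α (f * g) = ∑ q ∈ splits α, lc α q • (pderivA d q.1 f * pderivA d q.2 g) :=
  (leibniz_exists α).choose_spec f g hf hg

lemma smo_affine {f : Ed d → ℝ} (hf : Smo f) (y : Ed d) (r : ℝ) : Smo (fun x => f (y + r • x)) :=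
  ContDiff.comp hf (contDiff_const.add (contDiff_id.const_smul r))

lemma pderivI_affine {f : Ed d → ℝ} (hf : Smo f) (y : Ed d) (r : ℝ) (i : Fin d) :
    pderivI d i (fun x => f (y + r • x)) = fun x => r * pderivI d i f (y + r • x) := by
  funext x
  unfold pderivI
  have h1 : HasFDerivAt (fun x : Ed d => y + r • x) (r • ContinuousLinearMap.id ℝ (Ed d)) x :=
    ((hasFDerivAt_id x).const_smul r).const_add y
  have h2 := ((hf.diff (y + r • x)).hasFDerivAt).comp x h1
  have h3 : fderiv ℝ (fun x => f (y + r • x)) x = _ := h2.fderiv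
  rw [h3]
  simp

lemma pderivA_affine {f : Ed d → ℝ} (hf : Smo f) (y : Ed d) (r : ℝ) (α : Fin d → ℕ) :
    pderivA d α (fun x => f (y + r • x)) = fun x => r ^ ord α * pderivA d α f (y + r • x) := by
  induction α using mi_induction with
  | h0 => simp [pderivA_zero, ord_zero]
  | hs α i ih =>
    rw [pderivA_succ (smo_affine hf y r), ih, pderivA_succ hf]
    have : (fun x => r ^ ord α * pderivA d α f (y + r • x)) =
      (r ^ ord α) • (fun x => pderivA d α f (y + r • x)) := by funext x; simp
    rw [this, pderivI_smul (smo_affine (hf.pderivA α) y r), pderivI_affine (hf.pderivA α)]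
    funext x
    simp [ord_add, pow_succ]
    ring

lemma tsupport_pderivI (f : Ed d → ℝ) (i : Fin d) : tsupport (pderivI d i f) ⊆ tsupport f := by
  refine closure_minimal ?_ (isClosed_tsupport f)
  intro x hx
  by_contra hn
  apply hx
  have := notMem_tsupport_iff_eventuallyEq.mp hn
  unfold pderivI
  rw [this.fderiv_eq]
  simp

lemma tsupport_pderivA {f : Ed d → ℝ} (hf : Smo f) (α : Fin d → ℕ) :
    tsupport (pderivA d α f) ⊆ tsupport f := by
  induction α using mi_induction with
  | h0 => rw [pderivA_zero]
  | hs α i ih => rw [pderivA_succ hf]; exact (tsupport_pderivI _ _).trans ih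

lemma hcs_pderivA {f : Ed d → ℝ} (hf : Smo f) (hc : HasCompactSupport f) (α : Fin d → ℕ) :
    HasCompactSupport (pderivA d α f) :=
  hc.of_isClosed_subset (isClosed_tsupport _) (tsupport_pderivA hf α)

lemma pderivI_eventuallyEq {f g : Ed d → ℝ} {x : Ed d} (h : f =ᶠ[𝓝 x] g) (i : Fin d) :
    pderivI d i f =ᶠ[𝓝 x] pderivI d i g := by
  have := h.fderiv (𝕜 := ℝ)
  filter_upwards [this] with y hy
  simp [pderivI, hy]

lemma pderivA_eventuallyEq {f g : Ed d → ℝ} (hf : Smo f) (hg : Smo g) {x : Ed d}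
    (h : f =ᶠ[𝓝 x] g) (α : Fin d → ℕ) :
    pderivA d α f =ᶠ[𝓝 x] pderivA d α g := by
  induction α using mi_induction with
  | h0 => simpa [pderivA_zero] using h
  | hs α i ih => rw [pderivA_succ hf, pderivA_succ hg]; exact pderivI_eventuallyEq ih i

lemma ibp_I {f φ : Ed d → ℝ} (hf : Smo f) (hφ : Smo φ) (hc : HasCompactSupport φ) (i : Fin d) :
    ∫ x, f x * pderivI d i φ x = - ∫ x, pderivI d i f x * φ x := by
  have hc' : HasCompactSupport (pderivI d i φ) :=
    hc.of_isClosed_subset (isClosed_tsupport _) (tsupport_pderivI _ _)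
  apply integral_mul_fderiv_eq_neg_fderiv_mul_of_integrable
  · exact ((hf.pderivI i).cont.mul hφ.cont).integrable_of_hasCompactSupport hc.mul_left
  · exact (hf.cont.mul (hφ.pderivI i).cont).integrable_of_hasCompactSupport hc'.mul_left
  · exact (hf.cont.mul hφ.cont).integrable_of_hasCompactSupport hc.mul_left
  · intro x _; exact hf.diff x
  · intro x _; exact hφ.diff x

lemma ibp_A {f φ : Ed d → ℝ} (hf : Smo f) (hφ : Smo φ) (hc : HasCompactSupport φ) (α : Fin d → ℕ) :
    ∫ x, f x * pderivA d α φ x = (-1) ^ ord α * ∫ x, pderivA d α f x * φ x := by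
  induction α using mi_induction generalizing f with
  | h0 => simp [pderivA_zero, ord_zero]
  | hs α i ih =>
    rw [pderivA_succ hφ, ibp_I hf (hφ.pderivA α) (hcs_pderivA hφ hc α), ih (hf.pderivI i)]
    have : pderivA d α (pderivI d i f) = pderivA d (α + Pi.single i 1) f := by
      clear ih
      induction α using mi_induction with
      | h0 => rw [pderivA_zero, pderivA_succ hf, pderivA_zero]
      | hs β j ihh =>
        rw [pderivA_succ (hf.pderivI i), ihh, pderivA_succ hf, pderivA_succ hf, pderivA_succ hf,
          pderivI_comm (hf.pderivA β)]
    rw [this, ord_add, ord_single]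
    ring

end Calc

section Sob
variable {d : ℕ}

/-- Sum of `L^p` norms of the derivatives of order at most `k`. -/
def SN (p : ℝ≥0) (k : ℕ) (f : Ed d → ℝ) : ℝ≥0∞ :=
  ∑ α ∈ multiIdx d k, eLpNorm (pderivA d α f) p volume

lemma le_SN (p : ℝ≥0) {k : ℕ} (f : Ed d → ℝ) {α : Fin d → ℕ} (h : ord α ≤ k) :
    eLpNorm (pderivA d α f) p volume ≤ SN p k f :=
  Finset.single_le_sum (f := fun α => eLpNorm (pderivA d α f) p volume)
    (fun _ _ => zero_le) (mem_multiIdx.mpr h)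

lemma pderivA_pderivI {f : Ed d → ℝ} (hf : Smo f) (α : Fin d → ℕ) (i : Fin d) :
    pderivA d α (pderivI d i f) = pderivA d (α + Pi.single i 1) f := by
  induction α using mi_induction with
  | h0 => rw [pderivA_zero, pderivA_succ hf, pderivA_zero]
  | hs β j ihh =>
    rw [pderivA_succ (hf.pderivI i), ihh, pderivA_succ hf, pderivA_succ hf, pderivA_succ hf,
      pderivI_comm (hf.pderivA β)]

lemma pderivA_pderivA {f : Ed d → ℝ} (hf : Smo f) (α β : Fin d → ℕ) :
    pderivA d α (pderivA d β f) = pderivA d (α + β) f := by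
  induction α using mi_induction with
  | h0 => rw [pderivA_zero, zero_add]
  | hs α j ih =>
    rw [pderivA_succ (hf.pderivA β), ih, ← pderivA_succ hf]
    congr 1
    abel

lemma SN_pderivA_le (p : ℝ≥0) {k n : ℕ} {f : Ed d → ℝ} (hf : Smo f) (β : Fin d → ℕ)
    (h : k + ord β ≤ n) :
    SN p k (pderivA d β f) ≤ (multiIdx d k).card * SN p n f := by
  have : ∀ α ∈ multiIdx d k, eLpNorm (pderivA d α (pderivA d β f)) p volume ≤ SN p n f := by
    intro α hα
    rw [pderivA_pderivA hf]
    apply le_SN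
    rw [ord_add]
    have := mem_multiIdx.mp hα
    omega
  calc SN p k (pderivA d β f) ≤ ∑ α ∈ multiIdx d k, SN p n f := Finset.sum_le_sum this
    _ = _ := by rw [Finset.sum_const, nsmul_eq_mul]

lemma enorm_fderiv_le {f : Ed d → ℝ} (x : Ed d) :
    ‖fderiv ℝ f x‖ₑ ≤ ∑ i, ‖pderivI d i f x‖ₑ := by
  have h : ‖fderiv ℝ f x‖ ≤ ∑ i, ‖pderivI d i f x‖ := by
    refine ContinuousLinearMap.opNorm_le_bound _ (Finset.sum_nonneg fun _ _ => norm_nonneg _) ?_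
    intro v
    have hv : v = ∑ i, v i • (EuclideanSpace.single i (1 : ℝ) : Ed d) := by
      ext j
      simp [Finset.sum_apply, Pi.single_apply]
    conv_lhs => rw [hv]
    rw [map_sum, Finset.sum_mul]
    refine (norm_sum_le _ _).trans (Finset.sum_le_sum fun i _ => ?_)
    rw [map_smul, norm_smul, mul_comm]
    exact mul_le_mul_of_nonneg_left (PiLp.norm_apply_le v i) (norm_nonneg _)
  calc ‖fderiv ℝ f x‖ₑ = ENNReal.ofReal ‖fderiv ℝ f x‖ := (ofReal_norm _).symm
    _ ≤ ENNReal.ofReal (∑ i, ‖pderivI d i f x‖) := ENNReal.ofReal_le_ofReal h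
    _ = _ := by
      rw [ENNReal.ofReal_sum_of_nonneg (fun _ _ => norm_nonneg _)]
      simp only [ofReal_norm]

lemma eLpNorm_fderiv_le {f : Ed d → ℝ} (hf : Smo f) (q : ℝ≥0∞) (hq : 1 ≤ q) :
    eLpNorm (fderiv ℝ f) q volume ≤ ∑ i, eLpNorm (pderivI d i f) q volume := by
  calc eLpNorm (fderiv ℝ f) q volume
      ≤ eLpNorm (∑ i, fun x => ‖pderivI d i f x‖ₑ) q volume := by
        apply eLpNorm_mono_enorm
        intro x
        rw [Finset.sum_apply]
        simpa using enorm_fderiv_le x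
    _ ≤ ∑ i, eLpNorm (fun x => ‖pderivI d i f x‖ₑ) q volume := by
        apply eLpNorm_sum_le _ hq
        intro i _
        exact (hf.pderivI i).cont.enorm.aestronglyMeasurable
    _ = _ := by simp [eLpNorm_enorm]

lemma supp_pderivI {f : Ed d → ℝ} {S : Set (Ed d)} (h : tsupport f ⊆ S) (i : Fin d) :
    tsupport (pderivI d i f) ⊆ S := (tsupport_pderivI f i).trans h

lemma pderivA_single {f : Ed d → ℝ} (hf : Smo f) (i : Fin d) :
    pderivA d (Pi.single i 1) f = pderivI d i f := by
  have := pderivA_succ hf 0 i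
  rwa [zero_add, pderivA_zero] at this

/-- Sobolev embedding into `L^q`, `q < ∞`. -/
lemma sob (hd : 2 ≤ d) (p : ℝ≥0) (hp : 1 ≤ p) (k : ℕ) (q : ℝ≥0) (hq : 1 ≤ q)
    (h : (p : ℝ)⁻¹ - k / d ≤ (q : ℝ)⁻¹) : ∃ C : ℝ≥0, ∀ f : Ed d → ℝ, Smo f →
      tsupport f ⊆ closedBall 0 1 → eLpNorm f q volume ≤ C * SN p k f := by
  have hd0 : (0 : ℝ) < d := by exact_mod_cast (by omega : 0 < d)
  have hd2 : (2 : ℝ) ≤ d := by exact_mod_cast hd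
  induction k generalizing q with
  | zero =>
    have hqp : q ≤ p := by
      simp only [Nat.cast_zero, zero_div, sub_zero] at h
      have hq0 : (0 : ℝ) < q := by exact_mod_cast (by positivity : 0 < q)
      have hp0 : (0 : ℝ) < p := by exact_mod_cast (by positivity : 0 < p)
      exact_mod_cast (inv_le_inv₀ hp0 hq0).mp h
    set V : ℝ≥0∞ := volume (closedBall (0 : Ed d) 1) ^ (1 / (q : ℝ≥0∞).toReal - 1 / (p : ℝ≥0∞).toReal) with hV
    have hVt : V ≠ ⊤ := by
      apply ENNReal.rpow_ne_top_of_nonneg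
      · simp only [Nat.cast_zero, zero_div, sub_zero] at h
        simpa [sub_nonneg] using h
      · exact measure_closedBall_lt_top.ne
    refine ⟨V.toNNReal, fun f hf hs => ?_⟩
    have h1 : Function.support f ⊆ closedBall 0 1 := (subset_tsupport f).trans hs
    rw [ENNReal.coe_toNNReal hVt, ← eLpNorm_restrict_eq_of_support_subset h1]
    refine (eLpNorm_le_eLpNorm_mul_rpow_measure_univ (p := q) (q := p) (by exact_mod_cast hqp)
      hf.cont.aestronglyMeasurable).trans ?_
    rw [Measure.restrict_apply_univ, mul_comm, ← hV]
    gcongr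
    refine (eLpNorm_restrict_le f p volume _).trans ?_
    have := le_SN (k := 0) p f (α := 0) (by simp)
    rwa [pderivA_zero] at this
  | succ k ih =>
    have hq0 : 0 < q := by positivity
    set q' : ℝ≥0 := (min 1 (q⁻¹ + (d : ℝ≥0)⁻¹))⁻¹ with hq'
    have hdn : (0 : ℝ≥0) < d := by exact_mod_cast (by omega : 0 < d)
    have hmpos : 0 < min 1 (q⁻¹ + (d : ℝ≥0)⁻¹) := lt_min one_pos (by positivity)
    have hq'1 : 1 ≤ q' := by
      rw [hq']
      exact (one_le_inv₀ hmpos).mpr (min_le_left _ _)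
    have hq'd : q' < d := by
      rw [hq', inv_lt_comm₀ hmpos hdn]
      refine lt_min ?_ ?_
      · apply inv_lt_one_of_one_lt₀
        exact_mod_cast (by omega : 1 < d)
      · exact lt_add_of_pos_left _ (by positivity)
    have hinv : ((q' : ℝ≥0) : ℝ)⁻¹ = min 1 ((q : ℝ)⁻¹ + (d : ℝ)⁻¹) := by
      rw [hq']; push_cast; rw [inv_inv]
    have hk : (p : ℝ)⁻¹ - k / d ≤ ((q' : ℝ≥0) : ℝ)⁻¹ := by
      rw [hinv]
      refine le_min ?_ ?_
      · have h1 : (p : ℝ)⁻¹ ≤ 1 := inv_le_one_of_one_le₀ (by exact_mod_cast hp)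
        have h2 : 0 ≤ (k : ℝ) / d := by positivity
        linarith
      · push_cast at h
        rw [add_div, one_div] at h
        linarith
    obtain ⟨C, hC⟩ := ih q' hq'1 hk
    have hfin : Module.finrank ℝ (Ed d) = d := by simp
    refine ⟨eLpNormLESNormFDerivOfLeConst ℝ (volume : Measure (Ed d)) (closedBall 0 1) q' q *
      (d * (C * (multiIdx d k).card)), fun f hf hs => ?_⟩
    have h1 : Function.support f ⊆ closedBall 0 1 := (subset_tsupport f).trans hs
    have key := eLpNorm_le_eLpNorm_fderiv_of_le (μ := (volume : Measure (Ed d)))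
      (u := f) (s := closedBall 0 1) (hf.of_le (by exact_mod_cast le_top)) h1 hq'1
      (by rw [hfin]; exact hq'd) (q := q) (by
        rw [hfin]; push_cast; rw [hinv]
        have := min_le_right (1 : ℝ) ((q : ℝ)⁻¹ + (d : ℝ)⁻¹)
        linarith) isBounded_closedBall
    refine key.trans ?_
    rw [ENNReal.coe_mul, mul_assoc]
    gcongr
    refine (eLpNorm_fderiv_le hf q' (by exact_mod_cast hq'1)).trans ?_
    have hi : ∀ i : Fin d, eLpNorm (pderivI d i f) q' volume ≤
        C * ((multiIdx d k).card * SN p (k + 1) f) := by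
      intro i
      refine (hC _ (hf.pderivI i) (supp_pderivI hs i)).trans ?_
      gcongr
      rw [← pderivA_single hf]
      apply SN_pderivA_le p hf
      rw [ord_single]
    refine (Finset.sum_le_sum fun i _ => hi i).trans ?_
    rw [Finset.sum_const, Finset.card_univ, Fintype.card_fin, nsmul_eq_mul]
    push_cast
    rw [mul_assoc, mul_assoc]

lemma lint_affine (x : Ed d) {t : ℝ} (ht : 0 < t) (G : Ed d → ℝ≥0∞) :
    ∫⁻ w, G (x + t • w) = ENNReal.ofReal ((t ^ d)⁻¹) * ∫⁻ w, G w := by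
  have h1 : MeasurableEmbedding (fun w : Ed d => t • w) :=
    (Homeomorph.smulOfNeZero t ht.ne').measurableEmbedding
  have h2 := Measure.map_addHaar_smul (volume : Measure (Ed d)) ht.ne'
  have h3 : ∫⁻ w, G (x + w) ∂(Measure.map (fun w : Ed d => t • w) volume) = ∫⁻ w, G (x + t • w) :=
    h1.lintegral_map (fun w => G (x + w))
  rw [← h3]
  have h2' : Measure.map (fun w : Ed d => t • w) volume =
      ENNReal.ofReal |(t ^ Module.finrank ℝ (Ed d))⁻¹| • (volume : Measure (Ed d)) := h2
  rw [h2', lintegral_smul_measure, lintegral_add_left_eq_self]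
  rw [abs_of_pos (by positivity)]
  simp

end Sob

section Sup
variable {d : ℕ}

lemma sup_line {f : Ed d → ℝ} (hf : Smo f) (x w : Ed d) (hw : f (x + w) = 0) :
    ‖f x‖ₑ ≤ ∫⁻ t in Ioo (0 : ℝ) 1, ‖fderiv ℝ f (x + t • w)‖ₑ * ‖w‖ₑ := by
  have hder : ∀ t : ℝ, HasDerivAt (fun t : ℝ => f (x + t • w)) (fderiv ℝ f (x + t • w) w) t := by
    intro t
    have h1 : HasDerivAt (fun t : ℝ => x + t • w) w t := by
      simpa using ((hasDerivAt_id t).smul_const w).const_add x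
    exact ((hf.diff (x + t • w)).hasFDerivAt).comp_hasDerivAt t h1
  have hcf : Continuous (fderiv ℝ f) := ContDiff.continuous_fderiv hf (by simp)
  have hc : Continuous (fun t : ℝ => fderiv ℝ f (x + t • w) w) := by fun_prop
  have h := intervalIntegral.integral_eq_sub_of_hasDerivAt (a := 0) (b := 1)
    (fun t _ => hder t) (hc.intervalIntegrable _ _)
  simp only [one_smul, zero_smul, add_zero, hw, zero_sub] at h
  rw [intervalIntegral.integral_of_le zero_le_one] at h
  calc ‖f x‖ₑ = ‖∫ t in Ioc (0 : ℝ) 1, fderiv ℝ f (x + t • w) w‖ₑ := by rw [h, enorm_neg]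
    _ ≤ ∫⁻ t in Ioc (0 : ℝ) 1, ‖fderiv ℝ f (x + t • w) w‖ₑ := enorm_integral_le_lintegral_enorm _
    _ = ∫⁻ t in Ioo (0 : ℝ) 1, ‖fderiv ℝ f (x + t • w) w‖ₑ := by
      rw [Measure.restrict_congr_set Ioo_ae_eq_Ioc]
    _ ≤ _ := lintegral_mono fun t => ContinuousLinearMap.le_opENorm _ _

/-- Morrey: `W^{1,q} ⊂ L^∞` for `q > d`. -/
lemma morrey (hd : 2 ≤ d) (q : ℝ≥0) (hq : (d : ℝ) < q) : ∃ C : ℝ≥0, ∀ f : Ed d → ℝ, Smo f →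
    tsupport f ⊆ closedBall 0 1 → ∀ x, ‖f x‖ₑ ≤ C * eLpNorm (fderiv ℝ f) q volume := by
  have hd0 : (0 : ℝ) < d := by exact_mod_cast (by omega : 0 < d)
  have hq0 : (0 : ℝ) < q := hd0.trans hq
  have hq1 : (1 : ℝ) ≤ q := by
    have : (2 : ℝ) ≤ d := by exact_mod_cast hd
    linarith
  set w0 : Ed d := EuclideanSpace.single ⟨0, by omega⟩ (4 : ℝ) with hw0
  have hw0n : ‖w0‖ = 4 := by simp [hw0]
  set W : Set (Ed d) := ball w0 1 with hW
  set V : ℝ≥0∞ := volume W with hV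
  have hVt : V ≠ ⊤ := measure_ball_lt_top.ne
  have hV0 : V ≠ 0 := (measure_ball_pos volume w0 one_pos).ne'
  set J : ℝ≥0∞ := ∫⁻ t in Ioo (0 : ℝ) 1, ENNReal.ofReal (t ^ (-(d : ℝ) / q)) with hJ
  have hJt : J ≠ ⊤ := by
    have hinte : IntegrableOn (fun t : ℝ => t ^ (-(d : ℝ) / q)) (Ioo (0 : ℝ) 1) := by
      rw [intervalIntegral.integrableOn_Ioo_rpow_iff one_pos]
      rw [neg_div, neg_lt_neg_iff, div_lt_one hq0]
      exact hq
    have := hinte.lintegral_lt_top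
    exact this.ne
  set K : ℝ≥0∞ := V⁻¹ * (5 * (V ^ (1 - 1 / (q : ℝ)) * J)) with hK
  have hKt : K ≠ ⊤ := by
    refine ENNReal.mul_ne_top (ENNReal.inv_ne_top.mpr hV0) (ENNReal.mul_ne_top (by simp)
      (ENNReal.mul_ne_top (ENNReal.rpow_ne_top_of_nonneg ?_ hVt) hJt))
    rw [sub_nonneg, div_le_one hq0]
    exact hq1
  refine ⟨K.toNNReal, fun f hf hs x => ?_⟩
  rw [ENNReal.coe_toNNReal hKt]
  by_cases hx : x ∈ closedBall (0 : Ed d) 1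
  swap
  · have : f x = 0 := by
      by_contra hne
      exact hx (hs (subset_tsupport f hne))
    simp [this]
  rw [mem_closedBall_zero_iff] at hx
  have hWn : ∀ w ∈ W, 3 < ‖w‖ ∧ ‖w‖ < 5 := by
    intro w hw
    rw [hW, mem_ball, dist_eq_norm] at hw
    have h1 : ‖w‖ ≤ ‖w - w0‖ + ‖w0‖ := by simpa using norm_add_le (w - w0) w0
    have h2 : ‖w0‖ ≤ ‖w - w0‖ + ‖w‖ := by
      have := norm_sub_le w (w - w0)
      simp only [sub_sub_cancel] at this
      linarith
    constructor <;> linarith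
  have hline : ∀ w ∈ W, ‖f x‖ₑ ≤ 5 * ∫⁻ t in Ioo (0 : ℝ) 1, ‖fderiv ℝ f (x + t • w)‖ₑ := by
    intro w hw
    obtain ⟨h3, h5⟩ := hWn w hw
    have h0 : f (x + w) = 0 := by
      by_contra hne
      have := hs (subset_tsupport f hne)
      rw [mem_closedBall_zero_iff] at this
      have h4 : ‖w‖ ≤ ‖x + w‖ + ‖x‖ := by
        have := norm_sub_le (x + w) x
        simpa using this
      linarith
    refine (sup_line hf x w h0).trans ?_
    rw [lintegral_mul_const' _ _ enorm_ne_top, mul_comm]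
    gcongr
    rw [← ofReal_norm]
    calc ENNReal.ofReal ‖w‖ ≤ ENNReal.ofReal 5 := ENNReal.ofReal_le_ofReal h5.le
      _ = 5 := by simp
  have hcf : Continuous (fderiv ℝ f) := ContDiff.continuous_fderiv hf (by simp)
  have hinner : ∀ t ∈ Ioo (0 : ℝ) 1, ∫⁻ w in W, ‖fderiv ℝ f (x + t • w)‖ₑ ≤
      ENNReal.ofReal (t ^ (-(d : ℝ) / q)) * (eLpNorm (fderiv ℝ f) q volume * V ^ (1 - 1 / (q : ℝ))) := by
    intro t ht
    have hm : Continuous (fun w : Ed d => fderiv ℝ f (x + t • w)) := by fun_prop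
    have hH := eLpNorm_le_eLpNorm_mul_rpow_measure_univ (μ := volume.restrict W)
      (f := fun w : Ed d => fderiv ℝ f (x + t • w)) (p := 1) (q := q) (by exact_mod_cast hq1)
      hm.aestronglyMeasurable
    rw [eLpNorm_one_eq_lintegral_enorm, Measure.restrict_apply_univ] at hH
    simp only [ENNReal.toReal_one, div_one, ENNReal.coe_toReal] at hH
    refine hH.trans ?_
    rw [← mul_assoc]
    gcongr
    refine (eLpNorm_restrict_le _ _ _ _).trans ?_
    have hqne : (q : ℝ≥0∞) ≠ 0 := by exact_mod_cast hq0.ne'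
    rw [eLpNorm_eq_lintegral_rpow_enorm_toReal hqne ENNReal.coe_ne_top,
      eLpNorm_eq_lintegral_rpow_enorm_toReal hqne ENNReal.coe_ne_top]
    simp only [ENNReal.coe_toReal]
    rw [lint_affine x ht.1 (fun z => ‖fderiv ℝ f z‖ₑ ^ (q : ℝ)),
      ENNReal.mul_rpow_of_nonneg _ _ (by positivity)]
    gcongr
    rw [ENNReal.ofReal_rpow_of_nonneg (by have := ht.1; positivity) (by positivity)]
    apply le_of_eq
    congr 1
    rw [← Real.rpow_natCast, ← Real.rpow_neg ht.1.le, ← Real.rpow_mul ht.1.le]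
    congr 1
    ring
  have hmeas : Measurable (Function.uncurry fun (w : Ed d) (t : ℝ) => ‖fderiv ℝ f (x + t • w)‖ₑ) := by
    apply Continuous.measurable
    apply Continuous.enorm
    apply hcf.comp
    fun_prop
  have hmain : V * ‖f x‖ₑ ≤ 5 * (J * (eLpNorm (fderiv ℝ f) q volume * V ^ (1 - 1 / (q : ℝ)))) := by
    calc V * ‖f x‖ₑ = ∫⁻ w in W, ‖f x‖ₑ := by rw [setLIntegral_const, mul_comm]
      _ ≤ ∫⁻ w in W, 5 * ∫⁻ t in Ioo (0 : ℝ) 1, ‖fderiv ℝ f (x + t • w)‖ₑ :=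
        setLIntegral_mono' measurableSet_ball hline
      _ = 5 * ∫⁻ w in W, ∫⁻ t in Ioo (0 : ℝ) 1, ‖fderiv ℝ f (x + t • w)‖ₑ :=
        lintegral_const_mul' _ _ (by simp)
      _ = 5 * ∫⁻ t in Ioo (0 : ℝ) 1, ∫⁻ w in W, ‖fderiv ℝ f (x + t • w)‖ₑ := by
        rw [lintegral_lintegral_swap hmeas.aemeasurable]
      _ ≤ 5 * ∫⁻ t in Ioo (0 : ℝ) 1, ENNReal.ofReal (t ^ (-(d : ℝ) / q)) *
          (eLpNorm (fderiv ℝ f) q volume * V ^ (1 - 1 / (q : ℝ))) := by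
        gcongr 5 * ?_
        exact setLIntegral_mono' measurableSet_Ioo hinner
      _ = _ := by
        rw [lintegral_mul_const'']
        have : Measurable (fun t : ℝ => ENNReal.ofReal (t ^ (-(d : ℝ) / q))) := by fun_prop
        exact this.aemeasurable
  calc ‖f x‖ₑ = V⁻¹ * (V * ‖f x‖ₑ) := by
        rw [← mul_assoc, ENNReal.inv_mul_cancel hV0 hVt, one_mul]
    _ ≤ V⁻¹ * (5 * (J * (eLpNorm (fderiv ℝ f) q volume * V ^ (1 - 1 / (q : ℝ))))) := by gcongr
    _ = _ := by rw [hK]; ring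

lemma sup_coord {f : Ed d → ℝ} (hf : Smo f) (hc : HasCompactSupport f) (x : Fin d → ℝ) (i : Fin d) :
    ‖f (WithLp.toLp 2 x)‖ₑ ≤ ∫⁻ t, ‖pderivI d i f (WithLp.toLp 2 (Function.update x i t))‖ₑ := by
  have hder : ∀ t : ℝ, HasDerivAt (fun t : ℝ => f (WithLp.toLp 2 (Function.update x i t)))
      (pderivI d i f (WithLp.toLp 2 (Function.update x i t))) t := by
    intro t
    have h1 : HasDerivAt (fun t : ℝ => (WithLp.toLp 2 (Function.update x i t) : Ed d))
        (EuclideanSpace.single i 1) t := by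
      have h0 := hasDerivAt_update x i t
      exact ((PiLp.continuousLinearEquiv 2 ℝ (fun _ : Fin d => ℝ)).symm.hasFDerivAt).comp_hasDerivAt t h0
    exact ((hf.diff _).hasFDerivAt).comp_hasDerivAt t h1
  have hderiv : deriv (fun t : ℝ => f (WithLp.toLp 2 (Function.update x i t))) =
      fun t => pderivI d i f (WithLp.toLp 2 (Function.update x i t)) := by
    funext t; exact (hder t).deriv
  have hcl : Topology.IsClosedEmbedding (fun t : ℝ => (WithLp.toLp 2 (Function.update x i t) : Ed d)) :=
    ((PiLp.homeomorph 2 (fun _ : Fin d => ℝ)).symm.isClosedEmbedding).comp (isClosedEmbedding_update x i)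
  have hcont : Continuous (fun t => pderivI d i f (WithLp.toLp 2 (Function.update x i t))) :=
    (hf.pderivI i).cont.comp hcl.continuous
  have hC1 : ContDiff ℝ 1 (fun t : ℝ => f (WithLp.toLp 2 (Function.update x i t))) := by
    rw [contDiff_one_iff_deriv]
    refine ⟨fun t => (hder t).differentiableAt, ?_⟩
    rw [hderiv]; exact hcont
  have := HasCompactSupport.enorm_le_lintegral_Ici_deriv hC1 (hc.comp_isClosedEmbedding hcl) (x i)
  simp only [Function.update_eq_self] at this
  refine this.trans ?_
  rw [hderiv]
  exact lintegral_mono' Measure.restrict_le_self le_rfl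

/-- indicator multi-index -/
def oneIdx (s : Finset (Fin d)) : Fin d → ℕ := ∑ i ∈ s, Pi.single i 1

lemma sup_marginal {f : Ed d → ℝ} (hf : Smo f) (hc : HasCompactSupport f) (s : Finset (Fin d)) :
    ∀ x : Fin d → ℝ, ‖f (WithLp.toLp 2 x)‖ₑ ≤
      lmarginal (fun _ : Fin d => (volume : Measure ℝ)) s
        (fun z => ‖pderivA d (oneIdx s) f (WithLp.toLp 2 z)‖ₑ) x := by
  classical
  induction s using Finset.induction_on with
  | empty => intro x; simp [oneIdx, pderivA_zero]
  | insert i s hi ih =>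
    intro x
    refine (ih x).trans ?_
    have hmeas : Measurable fun z : Fin d → ℝ =>
        ‖pderivA d (oneIdx (insert i s)) f (WithLp.toLp 2 z)‖ₑ := by
      apply Continuous.measurable
      apply Continuous.enorm
      exact (hf.pderivA _).cont.comp (PiLp.continuous_toLp 2 _)
    rw [lmarginal_insert' _ hmeas hi]
    apply lmarginal_mono
    intro z
    have := sup_coord (hf.pderivA (oneIdx s)) (hcs_pderivA hf hc _) z i
    rw [← pderivA_succ hf] at this
    have he : oneIdx (insert i s) = oneIdx s + Pi.single i 1 := by
      unfold oneIdx; rw [Finset.sum_insert hi, add_comm]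
    rw [he]
    exact this

lemma sup_one {f : Ed d → ℝ} (hf : Smo f) (hc : HasCompactSupport f) (x : Ed d) :
    ‖f x‖ₑ ≤ ∫⁻ z, ‖pderivA d (oneIdx Finset.univ) f z‖ₑ := by
  have := sup_marginal hf hc Finset.univ (WithLp.ofLp x)
  rw [lmarginal_univ] at this
  refine this.trans (le_of_eq ?_)
  exact (PiLp.volume_preserving_toLp (Fin d)).lintegral_comp_emb
    (MeasurableEquiv.toLp 2 (Fin d → ℝ)).measurableEmbedding
    (fun z : Ed d => ‖pderivA d (oneIdx Finset.univ) f z‖ₑ)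

lemma ord_oneIdx : ord (oneIdx (Finset.univ : Finset (Fin d))) = d := by
  unfold oneIdx ord
  simp [Finset.sum_apply, Pi.single_apply]

/-- Condition under which the Kondratiev spaces are algebras. -/
def AlgCond (d m : ℕ) (p : ℝ≥0) : Prop := (1 < p ∧ (d : ℝ) / p < m) ∨ (p = 1 ∧ d ≤ m)

lemma sup_sob (hd : 2 ≤ d) (m : ℕ) (p : ℝ≥0) (h : AlgCond d m p) :
    ∃ C : ℝ≥0, ∀ f : Ed d → ℝ, Smo f → tsupport f ⊆ closedBall 0 1 → ∀ x,
      ‖f x‖ₑ ≤ C * SN p m f := by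
  have hd0 : (0 : ℝ) < d := by exact_mod_cast (by omega : 0 < d)
  rcases h with ⟨hp, hm⟩ | ⟨hp, hm⟩
  · have hp' : (1 : ℝ) < p := by exact_mod_cast hp
    have hp0 : (0 : ℝ) < p := by linarith
    have hm0 : 0 < m := by
      rcases Nat.eq_zero_or_pos m with h0 | h0
      · subst h0
        have : 0 < (d : ℝ) / p := by positivity
        simp only [Nat.cast_zero] at hm
        linarith
      · exact h0
    -- choose `q`
    have hlt : (p : ℝ)⁻¹ - ((m - 1 : ℕ) : ℝ) / d < (d : ℝ)⁻¹ := by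
      rw [Nat.cast_sub hm0]
      have h1 : (d : ℝ) / p / d < m / d := by gcongr
      have h2 : (d : ℝ) / p / d = (p : ℝ)⁻¹ := by field_simp
      rw [h2] at h1
      push_cast
      rw [sub_div, one_div]
      linarith
    obtain ⟨s, hs1, hs2⟩ := exists_between (max_lt hlt (inv_pos.mpr hd0))
    have hs0 : 0 < s := lt_of_le_of_lt (le_max_right _ _) hs1
    set q : ℝ≥0 := ⟨s⁻¹, (inv_pos.mpr hs0).le⟩ with hq
    have hqr : (q : ℝ) = s⁻¹ := rfl
    have hqd : (d : ℝ) < q := by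
      rw [hqr, lt_inv_comm₀ hd0 hs0]; exact hs2
    have hq1 : 1 ≤ q := by
      have : (1 : ℝ) ≤ q := by
        have : (2 : ℝ) ≤ d := by exact_mod_cast hd
        linarith
      exact_mod_cast this
    obtain ⟨C1, hC1⟩ := morrey hd q hqd
    obtain ⟨C2, hC2⟩ := sob hd p hp.le (m - 1) q hq1 (by
      rw [hqr, inv_inv]; exact ((le_max_left _ _).trans_lt hs1).le)
    refine ⟨C1 * (d * (C2 * (multiIdx d (m - 1)).card)), fun f hf hsu x => ?_⟩
    refine (hC1 f hf hsu x).trans ?_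
    rw [ENNReal.coe_mul, mul_assoc]
    gcongr
    refine (eLpNorm_fderiv_le hf q (by exact_mod_cast hq1)).trans ?_
    have hi : ∀ i : Fin d, eLpNorm (pderivI d i f) q volume ≤
        C2 * ((multiIdx d (m - 1)).card * SN p m f) := by
      intro i
      refine (hC2 _ (hf.pderivI i) (supp_pderivI hsu i)).trans ?_
      gcongr
      rw [← pderivA_single hf]
      apply SN_pderivA_le p hf
      rw [ord_single]
      omega
    refine (Finset.sum_le_sum fun i _ => hi i).trans ?_
    rw [Finset.sum_const, Finset.card_univ, Fintype.card_fin, nsmul_eq_mul]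
    push_cast
    rw [mul_assoc, mul_assoc]
  · refine ⟨1, fun f hf hsu x => ?_⟩
    have hc : HasCompactSupport f :=
      (isCompact_closedBall (0 : Ed d) 1).of_isClosed_subset (isClosed_tsupport f) hsu
    refine (sup_one hf hc x).trans ?_
    subst hp
    rw [ENNReal.coe_one, one_mul, ← eLpNorm_one_eq_lintegral_enorm]
    exact le_SN 1 f (by rw [ord_oneIdx]; exact hm)

/-- Bilinear estimate for compactly supported smooth functions. -/
lemma bilin (hd : 2 ≤ d) (m : ℕ) (p : ℝ≥0) (h : AlgCond d m p) (β γ : Fin d → ℕ)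
    (hbg : ord β + ord γ ≤ m) :
    ∃ C : ℝ≥0, ∀ f g : Ed d → ℝ, Smo f → Smo g → tsupport f ⊆ closedBall 0 1 →
      tsupport g ⊆ closedBall 0 1 →
      eLpNorm (pderivA d β f * pderivA d γ g) p volume ≤ C * (SN p m f * SN p m g) := by
  have hd0 : (0 : ℝ) < d := by exact_mod_cast (by omega : 0 < d)
  have hp1 : 1 ≤ p := by rcases h with h | h; exacts [h.1.le, h.1.ge]
  have hp1' : (1 : ℝ) ≤ p := by exact_mod_cast hp1
  have hp0 : (0 : ℝ) < p := by linarith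
  have hmp : (d : ℝ) ≤ m * p := by
    rcases h with h | h
    · have := h.2
      rw [div_lt_iff₀ hp0] at this
      exact this.le
    · rw [h.1]; simpa using h.2
  have hm0 : (0 : ℝ) < m := by
    by_contra hc
    have : (m : ℝ) * p ≤ 0 := mul_nonpos_of_nonpos_of_nonneg (not_lt.mp hc) hp0.le
    linarith
  by_cases hb : ord β = 0
  · obtain ⟨C, hC⟩ := sup_sob hd m p h
    refine ⟨C, fun f g hf hg hsf hsg => ?_⟩
    rw [eq_zero_of_ord hb, pderivA_zero]
    have h1 := eLpNorm_smul_le_mul_eLpNorm (μ := (volume : Measure (Ed d))) (p := ⊤) (q := p) (r := p)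
      (f := pderivA d γ g) (φ := f) (hg.pderivA γ).cont.aestronglyMeasurable
      hf.cont.aestronglyMeasurable
    refine h1.trans ?_
    rw [← mul_assoc]
    gcongr
    · rw [eLpNorm_exponent_top]
      exact eLpNormEssSup_le_of_ae_enorm_bound (Eventually.of_forall (hC f hf hsf))
    · exact le_SN p g (by omega)
  by_cases hg0 : ord γ = 0
  · obtain ⟨C, hC⟩ := sup_sob hd m p h
    refine ⟨C, fun f g hf hg hsf hsg => ?_⟩
    rw [eq_zero_of_ord hg0, pderivA_zero]
    have h1 := eLpNorm_smul_le_mul_eLpNorm (μ := (volume : Measure (Ed d))) (p := p) (q := ⊤) (r := p)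
      (f := g) (φ := pderivA d β f) hg.cont.aestronglyMeasurable
      (hf.pderivA β).cont.aestronglyMeasurable
    refine h1.trans ?_
    calc _ ≤ SN p m f * (C * SN p m g) := by
          gcongr
          · exact le_SN p f (by omega)
          · rw [eLpNorm_exponent_top]
            exact eLpNormEssSup_le_of_ae_enorm_bound (Eventually.of_forall (hC g hg hsg))
      _ = _ := by ring
  -- the remaining case
  have hb1 : (1 : ℝ) ≤ ord β := by exact_mod_cast Nat.one_le_iff_ne_zero.mpr hb
  have hg1 : (1 : ℝ) ≤ ord γ := by exact_mod_cast Nat.one_le_iff_ne_zero.mpr hg0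
  have hbg' : (ord β : ℝ) + ord γ ≤ m := by exact_mod_cast hbg
  set b : ℝ := ((ord β : ℕ) : ℝ) with hbdef
  set c : ℝ := ((ord γ : ℕ) : ℝ) with hcdef
  have hmb : 0 < (m : ℝ) - b := by linarith
  set q1 : ℝ≥0 := ⟨m * p / b, by positivity⟩ with hq1
  set q2 : ℝ≥0 := ⟨m * p / (m - b), by positivity⟩ with hq2
  have hq1r : (q1 : ℝ) = m * p / b := rfl
  have hq2r : (q2 : ℝ) = m * p / (m - b) := rfl
  have h1q1 : 1 ≤ q1 := by
    have : (1 : ℝ) ≤ q1 := by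
      rw [hq1r, le_div_iff₀ (by linarith)]
      nlinarith
    exact_mod_cast this
  have h1q2 : 1 ≤ q2 := by
    have : (1 : ℝ) ≤ q2 := by
      rw [hq2r, le_div_iff₀ hmb]
      nlinarith
    exact_mod_cast this
  have key : ∀ n : ℕ, (n : ℝ) ≤ m → (p : ℝ)⁻¹ - ((m - n : ℕ) : ℝ) / d ≤ n / (m * p) := by
    intro n hn
    rw [Nat.cast_sub (by exact_mod_cast hn)]
    have h1 : ((m : ℝ) - n) / (m * p) ≤ (m - n) / d := by
      apply div_le_div_of_nonneg_left _ hd0 hmp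
      linarith
    have h2 : ((m : ℝ) - n) / (m * p) = (p : ℝ)⁻¹ - n / (m * p) := by field_simp
    linarith
  obtain ⟨C1, hC1⟩ := sob hd p hp1 (m - ord β) q1 h1q1 (by
    rw [hq1r, inv_div]; exact key (ord β) (by linarith))
  obtain ⟨C2, hC2⟩ := sob hd p hp1 (m - ord γ) q2 h1q2 (by
    rw [hq2r, inv_div]
    refine (key (ord γ) (by linarith)).trans ?_
    gcongr
    linarith)
  have hHT : ENNReal.HolderTriple (q1 : ℝ≥0∞) q2 p := by
    constructor
    have e1 : q1⁻¹ + q2⁻¹ = p⁻¹ := by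
      ext
      push_cast
      rw [hq1r, hq2r]
      field_simp
      ring
    have hq1n : q1 ≠ 0 := by positivity
    have hq2n : q2 ≠ 0 := by positivity
    have hpn : p ≠ 0 := by positivity
    rw [← ENNReal.coe_inv hq1n, ← ENNReal.coe_inv hq2n, ← ENNReal.coe_inv hpn, ← e1]
    push_cast
    rfl
  refine ⟨(C1 * (multiIdx d (m - ord β)).card) * (C2 * (multiIdx d (m - ord γ)).card),
    fun f g hf hg hsf hsg => ?_⟩
  have h1 := eLpNorm_smul_le_mul_eLpNorm (μ := (volume : Measure (Ed d))) (p := q1) (q := q2) (r := p)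
      (f := pderivA d γ g) (φ := pderivA d β f) (hg.pderivA γ).cont.aestronglyMeasurable
      (hf.pderivA β).cont.aestronglyMeasurable
  refine h1.trans ?_
  calc _ ≤ (C1 * ((multiIdx d (m - ord β)).card * SN p m f)) *
        (C2 * ((multiIdx d (m - ord γ)).card * SN p m g)) := by
        gcongr
        · refine (hC1 _ (hf.pderivA β) ((tsupport_pderivA hf β).trans hsf)).trans ?_
          gcongr
          exact SN_pderivA_le p hf β (by omega)
        · refine (hC2 _ (hg.pderivA γ) ((tsupport_pderivA hg γ).trans hsg)).trans ?_
          gcongr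
          exact SN_pderivA_le p hg γ (by omega)
    _ = _ := by push_cast; ring

end Sup

section Loc
variable {d : ℕ}

/-- Weighted sum of `L^p(S)` norms of a family. -/
def WN (p : ℝ≥0) (m : ℕ) (r : ℝ) (S : Set (Ed d)) (E : (Fin d → ℕ) → Ed d → ℝ) : ℝ≥0∞ :=
  ∑ α ∈ multiIdx d m, ENNReal.ofReal (r ^ ord α) * eLpNorm (E α) p (volume.restrict S)

/-- The family of classical derivatives. -/
def fam (f : Ed d → ℝ) : (Fin d → ℕ) → Ed d → ℝ := fun α => pderivA d α f

lemma le_WN_one (p : ℝ≥0) {m : ℕ} (S : Set (Ed d)) (E : (Fin d → ℕ) → Ed d → ℝ)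
    {α : Fin d → ℕ} (h : ord α ≤ m) :
    eLpNorm (E α) p (volume.restrict S) ≤ WN p m 1 S E := by
  have := Finset.single_le_sum
    (f := fun α => ENNReal.ofReal (1 ^ ord α) * eLpNorm (E α) p (volume.restrict S))
    (fun _ _ => zero_le) (mem_multiIdx.mpr h)
  simpa [WN] using this

/-- cutoff function -/
def cutB (d : ℕ) : ContDiffBump (0 : Ed d) := ⟨1 / 2, 1, by norm_num, by norm_num⟩

lemma cut_smo : Smo (cutB d : Ed d → ℝ) := (cutB d).contDiff

lemma cut_ts : tsupport (cutB d : Ed d → ℝ) = closedBall 0 1 := (cutB d).tsupport_eq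

lemma cut_bound (p : ℝ≥0) (hp : 1 ≤ p) (m : ℕ) : ∃ C : ℝ≥0, ∀ F : Ed d → ℝ, Smo F →
    SN p m ((cutB d : Ed d → ℝ) * F) ≤ C * WN p m 1 (closedBall 0 1) (fam F) := by
  have hp' : (1 : ℝ≥0∞) ≤ p := by exact_mod_cast hp
  have key : ∀ α q : Fin d → ℕ, ∃ M : ℝ≥0, ∀ G : Ed d → ℝ, 
      eLpNorm (pderivA d q (cutB d : Ed d → ℝ) * G) p volume
        ≤ M * eLpNorm G p (volume.restrict (closedBall 0 1)) := by
    intro α q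
    have hcs : HasCompactSupport (pderivA d q (cutB d : Ed d → ℝ)) :=
      hcs_pderivA cut_smo (cutB d).hasCompactSupport q
    obtain ⟨M, hM⟩ := hcs.exists_bound_of_continuous (cut_smo.pderivA q).cont
    refine ⟨M.toNNReal, fun G => ?_⟩
    have hsub : Function.support (pderivA d q (cutB d : Ed d → ℝ) * G) ⊆ closedBall 0 1 := by
      rw [← cut_ts]
      intro x hx
      apply tsupport_pderivA cut_smo q
      apply subset_tsupport
      intro h0
      apply hx
      simp [h0]
    rw [← eLpNorm_restrict_eq_of_support_subset hsub]
    have := eLpNorm_le_nnreal_smul_eLpNorm_of_ae_le_mul (μ := volume.restrict (closedBall (0 : Ed d) 1))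
      (f := pderivA d q (cutB d : Ed d → ℝ) * G) (g := G) (c := M.toNNReal)
      (Eventually.of_forall fun x => ?_) p
    · simpa [ENNReal.smul_def] using this
    · rw [Pi.mul_apply, nnnorm_mul]
      gcongr
      rw [← NNReal.coe_le_coe]
      exact (hM x).trans (Real.le_coe_toNNReal M)
  choose M hM using key
  refine ⟨∑ α ∈ multiIdx d m, ∑ q ∈ splits α, ‖lc α q‖₊ * M α q.1, fun F hF => ?_⟩
  unfold SN
  push_cast
  rw [Finset.sum_mul]
  refine Finset.sum_le_sum fun α hα => ?_
  rw [leibniz α cut_smo hF, Finset.sum_mul]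
  refine (eLpNorm_sum_le (fun q _ => ?_) hp').trans (Finset.sum_le_sum fun q hq => ?_)
  · exact (((cut_smo.pderivA _).cont.mul (hF.pderivA _).cont).const_smul _).aestronglyMeasurable
  · rw [eLpNorm_const_smul, mul_assoc]
    rw [enorm_eq_nnnorm]
    gcongr
    refine (hM α q.1 _).trans ?_
    gcongr
    apply le_WN_one (E := fam F) 
    have h1 := mem_splits.mp hq
    have h2 := mem_multiIdx.mp hα
    rw [← h1, ord_add] at h2
    omega

lemma loc_unit (hd : 2 ≤ d) (m : ℕ) (p : ℝ≥0) (hp : 1 ≤ p) (h : AlgCond d m p) (β γ : Fin d → ℕ)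
    (hbg : ord β + ord γ ≤ m) : ∃ C : ℝ≥0, ∀ F G : Ed d → ℝ, Smo F → Smo G →
    eLpNorm (pderivA d β F * pderivA d γ G) p (volume.restrict (ball 0 (1 / 2)))
      ≤ C * (WN p m 1 (closedBall 0 1) (fam F) * WN p m 1 (closedBall 0 1) (fam G)) := by
  obtain ⟨C, hC⟩ := bilin hd m p h β γ hbg
  obtain ⟨C', hC'⟩ := cut_bound (d := d) p hp m
  refine ⟨C * (C' * C'), fun F G hF hG => ?_⟩
  have hs : ∀ F : Ed d → ℝ, tsupport ((cutB d : Ed d → ℝ) * F) ⊆ closedBall 0 1 := by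
    intro F
    rw [← cut_ts]
    exact tsupport_mul_subset_left
  have he : ∀ F : Ed d → ℝ, Smo F → ∀ α, ∀ x ∈ ball (0 : Ed d) (1 / 2),
      pderivA d α F x = pderivA d α ((cutB d : Ed d → ℝ) * F) x := by
    intro F hF α x hx
    have hev : F =ᶠ[𝓝 x] ((cutB d : Ed d → ℝ) * F) := by
      have := (cutB d).eventuallyEq_one_of_mem_ball (x := x) hx
      filter_upwards [this] with z hz
      simp [hz]
    exact (pderivA_eventuallyEq hF (cut_smo.mul hF) hev α).eq_of_nhds
  calc eLpNorm (pderivA d β F * pderivA d γ G) p (volume.restrict (ball 0 (1 / 2)))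
      = eLpNorm (pderivA d β ((cutB d : Ed d → ℝ) * F) * pderivA d γ ((cutB d : Ed d → ℝ) * G)) p
        (volume.restrict (ball 0 (1 / 2))) := by
        apply eLpNorm_congr_ae
        filter_upwards [ae_restrict_mem measurableSet_ball] with x hx
        simp only [Pi.mul_apply]
        rw [he F hF β x hx, he G hG γ x hx]
    _ ≤ eLpNorm (pderivA d β ((cutB d : Ed d → ℝ) * F) * pderivA d γ ((cutB d : Ed d → ℝ) * G)) p
        volume := eLpNorm_mono_measure _ Measure.restrict_le_self
    _ ≤ C * (SN p m ((cutB d : Ed d → ℝ) * F) * SN p m ((cutB d : Ed d → ℝ) * G)) :=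
        hC _ _ (cut_smo.mul hF) (cut_smo.mul hG) (hs F) (hs G)
    _ ≤ C * ((C' * WN p m 1 (closedBall 0 1) (fam F)) * (C' * WN p m 1 (closedBall 0 1) (fam G))) := by
        gcongr
        · exact hC' F hF
        · exact hC' G hG
    _ = _ := by push_cast; ring

lemma eLpNorm_affine (p : ℝ≥0) (hp : p ≠ 0) (y : Ed d) {r : ℝ} (hr : 0 < r) (S : Set (Ed d))
    (hS : MeasurableSet S) (f : Ed d → ℝ) :
    eLpNorm (fun x => f (y + r • x)) p (volume.restrict ((fun x => y + r • x) ⁻¹' S))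
      = ENNReal.ofReal ((r ^ d)⁻¹) ^ (1 / (p : ℝ)) * eLpNorm f p (volume.restrict S) := by
  have hm : Measurable (fun x : Ed d => y + r • x) := by fun_prop
  rw [← eLpNorm_indicator_eq_eLpNorm_restrict hS,
    ← eLpNorm_indicator_eq_eLpNorm_restrict (hm hS)]
  have hp0 : (p : ℝ≥0∞) ≠ 0 := by exact_mod_cast hp
  rw [eLpNorm_eq_lintegral_rpow_enorm_toReal hp0 (by simp),
    eLpNorm_eq_lintegral_rpow_enorm_toReal hp0 (by simp)]
  rw [ENNReal.coe_toReal, ← ENNReal.mul_rpow_of_nonneg _ _ (by positivity), ← lint_affine y hr]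
  rfl

lemma loc_scaled (hd : 2 ≤ d) (m : ℕ) (p : ℝ≥0) (hp : 1 ≤ p) (h : AlgCond d m p)
    (β γ : Fin d → ℕ)
    (hbg : ord β + ord γ ≤ m) : ∃ C : ℝ≥0, ∀ F G : Ed d → ℝ, Smo F → Smo G →
    ∀ (y : Ed d) (r : ℝ), 0 < r → 
    ENNReal.ofReal (r ^ (ord β + ord γ)) *
      eLpNorm (pderivA d β F * pderivA d γ G) p (volume.restrict (ball y (r / 2)))
      ≤ C * (ENNReal.ofReal ((r ^ d)⁻¹) ^ (1 / (p : ℝ)) * 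
        (WN p m r (closedBall y r) (fam F) * WN p m r (closedBall y r) (fam G))) := by
  obtain ⟨C, hC⟩ := loc_unit hd m p hp h β γ hbg
  refine ⟨C, fun F G hF hG y r hr => ?_⟩
  have hp0 : p ≠ 0 := (zero_lt_one.trans_le hp).ne'
  have hCC := hC _ _ (smo_affine hF y r) (smo_affine hG y r)
  set κ := ENNReal.ofReal ((r ^ d)⁻¹) ^ (1 / (p : ℝ)) with hκ
  have hκ0 : κ ≠ 0 := by
    rw [hκ]
    have : 0 < ENNReal.ofReal ((r ^ d)⁻¹) := ENNReal.ofReal_pos.mpr (by positivity)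
    exact (ENNReal.rpow_pos this ENNReal.ofReal_ne_top).ne'
  have hκt : κ ≠ ⊤ := ENNReal.rpow_ne_top_of_nonneg (by positivity) ENNReal.ofReal_ne_top
  have hpre1 : (fun x : Ed d => y + r • x) ⁻¹' (closedBall y r) = closedBall 0 1 := by
    ext x
    simp [norm_smul, abs_of_pos hr]
    constructor <;> intro hx <;> nlinarith
  have hpre2 : (fun x : Ed d => y + r • x) ⁻¹' (ball y (r / 2)) = ball 0 (1 / 2) := by
    ext x
    simp [norm_smul, abs_of_pos hr]
    constructor <;> intro hx <;> nlinarith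
  have hW : ∀ F : Ed d → ℝ, Smo F → WN p m 1 (closedBall 0 1) (fam (fun x => F (y + r • x)))
      = κ * WN p m r (closedBall y r) (fam F) := by
    intro F hF
    unfold WN
    rw [Finset.mul_sum]
    refine Finset.sum_congr rfl fun α _ => ?_
    unfold fam
    rw [pderivA_affine hF]
    have : (fun x => r ^ ord α * pderivA d α F (y + r • x)) 
      = (r ^ ord α) • (fun x => pderivA d α F (y + r • x)) := rfl
    rw [this, eLpNorm_const_smul, ← hpre1, 
      eLpNorm_affine p hp0 y hr _ measurableSet_closedBall, Real.enorm_of_nonneg (by positivity)]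
    simp only [one_pow, ENNReal.ofReal_one, one_mul]
    rw [← hκ]
    ring
  rw [hW F hF, hW G hG, pderivA_affine hF, pderivA_affine hG] at hCC
  have e : ((fun x => r ^ ord β * pderivA d β F (y + r • x)) * 
      (fun x => r ^ ord γ * pderivA d γ G (y + r • x))) 
      = (r ^ (ord β + ord γ)) • (fun x => (pderivA d β F * pderivA d γ G) (y + r • x)) := by
    ext x
    simp only [Pi.mul_apply, Pi.smul_apply, smul_eq_mul, pow_add]
    ring
  rw [e, eLpNorm_const_smul, ← hpre2,
      eLpNorm_affine p hp0 y hr _ measurableSet_ball, Real.enorm_of_nonneg (by positivity),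
      ← hκ] at hCC
  rw [← ENNReal.mul_le_mul_iff_right hκ0 hκt]
  calc _ = _ := by ring
    _ ≤ _ := hCC
    _ = _ := by ring

lemma lim_mul {ι : Type*} [MeasurableSpace ι] (μ ν : Measure ι) (hν : ν ≤ μ) (p : ℝ≥0) (hp : p ≠ 0) 
    (f g : ℕ → ι → ℝ) (F G : ι → ℝ) (hf : ∀ n, AEStronglyMeasurable (f n) μ)
    (hg : ∀ n, AEStronglyMeasurable (g n) μ) (hF : AEStronglyMeasurable F μ)
    (hG : AEStronglyMeasurable G μ)
    (h1 : Tendsto (fun n => eLpNorm (f n - F) p μ) atTop (𝓝 0))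
    (h2 : Tendsto (fun n => eLpNorm (g n - G) p μ) atTop (𝓝 0))
    (B : ℕ → ℝ≥0∞) (b : ℝ≥0∞) (hB : Tendsto B atTop (𝓝 b))
    (hle : ∀ n, eLpNorm (f n * g n) p ν ≤ B n) :
    eLpNorm (F * G) p ν ≤ b := by
  have hp0 : (p : ℝ≥0∞) ≠ 0 := by exact_mod_cast hp
  obtain ⟨s, hs, hs'⟩ := (tendstoInMeasure_of_tendsto_eLpNorm hp0 hf hF h1).exists_seq_tendsto_ae
  obtain ⟨t, ht, ht'⟩ := (tendstoInMeasure_of_tendsto_eLpNorm hp0 (fun n => hg (s n)) hG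
    (h2.comp hs.tendsto_atTop)).exists_seq_tendsto_ae
  have hae : ∀ᵐ x ∂ν, Tendsto (fun n => (f (s (t n)) * g (s (t n))) x) atTop (𝓝 ((F * G) x)) := by
    filter_upwards [ae_mono hν hs', ae_mono hν ht'] with x hx1 hx2
    exact (hx1.comp ht.tendsto_atTop).mul hx2
  have := Lp.eLpNorm_lim_le_liminf_eLpNorm (p := p) 
    (fun n => ((hf (s (t n))).mul (hg (s (t n)))).mono_measure hν) (F * G) hae
  refine this.trans ?_
  have hB' : Tendsto (fun n => B (s (t n))) atTop (𝓝 b) := 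
    hB.comp (hs.tendsto_atTop.comp ht.tendsto_atTop)
  rw [← hB'.liminf_eq]
  exact liminf_le_liminf (Eventually.of_forall fun n => hle _)

/-- The family `D` is, on `S`, the `L^p` limit of classical derivatives of smooth functions
along the sequence `u`. -/
structure ApproxBy (p : ℝ≥0) (m : ℕ) (S : Set (Ed d)) (D : (Fin d → ℕ) → Ed d → ℝ)
    (u : ℕ → Ed d → ℝ) : Prop where
  smo : ∀ n, Smo (u n)
  mem : ∀ α ∈ multiIdx d m, MemLp (D α) p (volume.restrict S)
  lim : ∀ α ∈ multiIdx d m,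
    Tendsto (fun n => eLpNorm (pderivA d α (u n) - D α) p (volume.restrict S)) atTop (𝓝 0)

lemma ApproxBy.mono {p : ℝ≥0} {m : ℕ} {S T : Set (Ed d)} {D : (Fin d → ℕ) → Ed d → ℝ}
    {u : ℕ → Ed d → ℝ} (h : ApproxBy p m S D u) (hT : T ⊆ S) : ApproxBy p m T D u where
  smo := h.smo
  mem := fun α hα => (h.mem α hα).mono_measure (Measure.restrict_mono_set _ hT)
  lim := fun α hα => tendsto_of_tendsto_of_tendsto_of_le_of_le tendsto_const_nhds (h.lim α hα)
    (fun _ => zero_le) (fun _ => eLpNorm_mono_measure _ (Measure.restrict_mono_set _ hT))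

lemma WN_mono_add (p : ℝ≥0) (hp : 1 ≤ p) (m : ℕ) (r : ℝ) (S : Set (Ed d)) 
    (E F : (Fin d → ℕ) → Ed d → ℝ) 
    (hE : ∀ α ∈ multiIdx d m, AEStronglyMeasurable (E α) (volume.restrict S))
    (hF : ∀ α ∈ multiIdx d m, AEStronglyMeasurable (F α) (volume.restrict S)) :
    WN p m r S (fun α => E α + F α) ≤ WN p m r S E + WN p m r S F := by
  unfold WN
  rw [← Finset.sum_add_distrib]
  refine Finset.sum_le_sum fun α hα => ?_
  rw [← mul_add]
  gcongr
  exact eLpNorm_add_le (hE α hα) (hF α hα) (by exact_mod_cast hp)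

lemma ApproxBy.tendsto_WN {p : ℝ≥0} {m : ℕ} {S : Set (Ed d)} {D : (Fin d → ℕ) → Ed d → ℝ}
    {u : ℕ → Ed d → ℝ} (h : ApproxBy p m S D u) (r : ℝ) :
    Tendsto (fun n => WN p m r S (fun α => pderivA d α (u n) - D α)) atTop (𝓝 0) := by
  unfold WN
  have : (0 : ℝ≥0∞) = ∑ α ∈ multiIdx d m, ENNReal.ofReal (r ^ ord α) * 0 := by simp
  rw [this]
  refine tendsto_finsetSum _ fun α hα => ?_
  exact ENNReal.Tendsto.const_mul (h.lim α hα) (Or.inr ENNReal.ofReal_ne_top)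

lemma ApproxBy.WN_lt_top {p : ℝ≥0} {m : ℕ} {S : Set (Ed d)} {D : (Fin d → ℕ) → Ed d → ℝ}
    {u : ℕ → Ed d → ℝ} (h : ApproxBy p m S D u) (r : ℝ) : WN p m r S D ≠ ⊤ := by
  unfold WN
  refine (ENNReal.sum_lt_top.mpr fun α hα => ?_).ne
  exact ENNReal.mul_lt_top ENNReal.ofReal_lt_top (h.mem α hα).eLpNorm_lt_top

lemma loc_approx (hd : 2 ≤ d) (m : ℕ) (p : ℝ≥0) (hp : 1 ≤ p) (h : AlgCond d m p)
    (β γ : Fin d → ℕ)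
    (hbg : ord β + ord γ ≤ m) : ∃ C : ℝ≥0, ∀ (D E : (Fin d → ℕ) → Ed d → ℝ) (y : Ed d) (r : ℝ),
    0 < r → ∀ u v, ApproxBy p m (closedBall y r) D u → ApproxBy p m (closedBall y r) E v →
    ENNReal.ofReal (r ^ (ord β + ord γ)) *
      eLpNorm (D β * E γ) p (volume.restrict (ball y (r / 2)))
      ≤ C * (ENNReal.ofReal ((r ^ d)⁻¹) ^ (1 / (p : ℝ)) * 
        (WN p m r (closedBall y r) D * WN p m r (closedBall y r) E)) := by
  obtain ⟨C, hC⟩ := loc_scaled hd m p hp h β γ hbg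
  refine ⟨C, fun D E y r hr u v hu hv => ?_⟩
  have hp0 : p ≠ 0 := (zero_lt_one.trans_le hp).ne'
  set κ := ENNReal.ofReal ((r ^ d)⁻¹) ^ (1 / (p : ℝ)) with hκ
  have hκt : κ ≠ ⊤ := ENNReal.rpow_ne_top_of_nonneg (by positivity) ENNReal.ofReal_ne_top
  set S := closedBall y r with hS
  set R := ENNReal.ofReal (r ^ (ord β + ord γ)) with hR
  have hR0 : R ≠ 0 := (ENNReal.ofReal_pos.mpr (by positivity)).ne'
  have hRt : R ≠ ⊤ := ENNReal.ofReal_ne_top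
  have hβ : β ∈ multiIdx d m := mem_multiIdx.mpr (by omega)
  have hγ : γ ∈ multiIdx d m := mem_multiIdx.mpr (by omega)
  have hb : ∀ {D : (Fin d → ℕ) → Ed d → ℝ} {u : ℕ → Ed d → ℝ}, ApproxBy p m S D u → ∀ n, 
      WN p m r S (fam (u n)) ≤ WN p m r S (fun α => pderivA d α (u n) - D α) + WN p m r S D := by
    intro D u hu n
    refine le_trans (le_of_eq ?_) (WN_mono_add p hp m r S (fun α => pderivA d α (u n) - D α) D ?_ ?_)
    · congr 1; ext α x; simp [fam]
    · intro α hα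
      exact (((hu.smo n).pderivA α).cont.aestronglyMeasurable).sub (hu.mem α hα).1
    · intro α hα
      exact (hu.mem α hα).1
  have ht : ∀ {D : (Fin d → ℕ) → Ed d → ℝ} {u : ℕ → Ed d → ℝ}, ApproxBy p m S D u → 
      Tendsto (fun n => WN p m r S (fun α => pderivA d α (u n) - D α) + WN p m r S D) atTop
        (𝓝 (WN p m r S D)) := by
    intro D u hu
    simpa using (hu.tendsto_WN r).add_const (WN p m r S D)
  have main := lim_mul (volume.restrict S) (volume.restrict (ball y (r / 2)))
    (Measure.restrict_mono_set _ ((ball_subset_ball (by linarith)).trans ball_subset_closedBall))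
    p hp0 (fun n => pderivA d β (u n)) (fun n => pderivA d γ (v n)) (D β) (E γ)
    (fun n => ((hu.smo n).pderivA β).cont.aestronglyMeasurable)
    (fun n => ((hv.smo n).pderivA γ).cont.aestronglyMeasurable) (hu.mem β hβ).1 (hv.mem γ hγ).1
    (hu.lim β hβ) (hv.lim γ hγ)
    (fun n => R⁻¹ * (C * (κ * 
      ((WN p m r S (fun α => pderivA d α (u n) - D α) + WN p m r S D) * 
      (WN p m r S (fun α => pderivA d α (v n) - E α) + WN p m r S E)))))
    (R⁻¹ * (C * (κ * (WN p m r S D * WN p m r S E)))) ?_ ?_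
  · calc _ ≤ R * (R⁻¹ * (C * (κ * (WN p m r S D * WN p m r S E)))) := by gcongr
      _ = _ := by rw [← mul_assoc, ENNReal.mul_inv_cancel hR0 hRt, one_mul]
  · refine ENNReal.Tendsto.const_mul (ENNReal.Tendsto.const_mul (ENNReal.Tendsto.const_mul 
      (ENNReal.Tendsto.mul (ht hu) (Or.inr (hv.WN_lt_top r)) (ht hv) (Or.inr (hu.WN_lt_top r)))
      (Or.inr hκt)) (Or.inr ENNReal.coe_ne_top)) (Or.inr (ENNReal.inv_ne_top.mpr hR0))
  · intro n
    have h1 := hC (u n) (v n) (hu.smo n) (hv.smo n) y r hr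
    rw [← hR, ← hκ] at h1
    calc eLpNorm (pderivA d β (u n) * pderivA d γ (v n)) p (volume.restrict (ball y (r / 2)))
        = R⁻¹ * (R * eLpNorm (pderivA d β (u n) * pderivA d γ (v n)) p 
            (volume.restrict (ball y (r / 2)))) := by
          rw [← mul_assoc, ENNReal.inv_mul_cancel hR0 hRt, one_mul]
      _ ≤ _ := by
          refine mul_le_mul' le_rfl (h1.trans ?_)
          gcongr
          · exact hb hu n
          · exact hb hv n

end Loc

section Moll
variable {d : ℕ}

lemma transl (p : ℝ≥0) (hp : 1 ≤ p) {f : Ed d → ℝ} (hf : MemLp f p volume) :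
    Tendsto (fun s : Ed d => eLpNorm (fun x => f (x - s) - f x) p volume) (𝓝 0) (𝓝 0) := by
  haveI : Fact ((1 : ℝ≥0∞) ≤ p) := ⟨by exact_mod_cast hp⟩
  let g : Ed d → C(Ed d, Ed d) := fun s => ⟨fun x => x - s, by fun_prop⟩
  have hg : Continuous g := by
    apply ContinuousMap.continuous_of_continuous_uncurry
    change Continuous (fun q : Ed d × Ed d => q.2 - q.1)
    fun_prop
  have hgm : ∀ s, MeasurePreserving (g s) (volume : Measure (Ed d)) volume := fun s =>
    measurePreserving_sub_right volume s
  have hc := (continuous_const (y := hf.toLp f)).compMeasurePreservingLp hg hgm (by simp)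
  have ht := hc.tendsto 0
  rw [Lp.tendsto_Lp_iff_tendsto_eLpNorm'] at ht
  refine ht.congr fun s => ?_
  apply eLpNorm_congr_ae
  have h1 := Lp.coeFn_compMeasurePreserving (hf.toLp f) (hgm s)
  have h2 := Lp.coeFn_compMeasurePreserving (hf.toLp f) (hgm 0)
  have h3 := hf.coeFn_toLp
  have h4 := (hgm s).quasiMeasurePreserving.ae_eq_comp h3
  have h5 := (hgm 0).quasiMeasurePreserving.ae_eq_comp h3
  filter_upwards [h1, h2, h4, h5] with x e1 e2 e4 e5
  simp only [Pi.sub_apply]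
  rw [e1, e2, e4, e5]
  simp [g]

lemma moll_bound (p : ℝ≥0) (hp : 1 ≤ p) {f : Ed d → ℝ} (hfm : StronglyMeasurable f)
    (hf : MemLp f p volume) (φ : ContDiffBump (0 : Ed d)) (ε : ℝ≥0∞)
    (h : ∀ s, ‖s‖ ≤ φ.rOut → eLpNorm (fun x => f (x - s) - f x) p volume ≤ ε) :
    eLpNorm (fun x => (∫ t, f t * φ.normed volume (x - t)) - f x) p volume ≤ ε := by
  have hp' : (1 : ℝ≥0∞) ≤ p := by exact_mod_cast hp
  have hp0 : p ≠ 0 := (zero_lt_one.trans_le hp).ne'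
  have hpr : (0 : ℝ) < p := by exact_mod_cast (zero_lt_one.trans_le hp)
  set w := φ.normed (volume : Measure (Ed d)) with hw
  have hwm : Measurable (fun s => ENNReal.ofReal (w s)) := 
    (φ.continuous_normed.measurable).ennreal_ofReal
  set ν : Measure (Ed d) := volume.withDensity (fun s => ENNReal.ofReal (w s)) with hν
  haveI : IsProbabilityMeasure ν := by
    constructor
    rw [hν, withDensity_apply _ MeasurableSet.univ, Measure.restrict_univ,
      ← ofReal_integral_eq_lintegral_ofReal φ.integrable_normed 
      (Eventually.of_forall φ.nonneg_normed), φ.integral_normed, ENNReal.ofReal_one]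
  have hνae : ∀ᵐ s ∂ν, ‖s‖ ≤ φ.rOut := by
    rw [hν, ae_withDensity_iff hwm]
    refine Eventually.of_forall fun s hs => ?_
    have : s ∈ Function.support w := by
      intro h0
      apply hs
      simp [h0]
    rw [hw, φ.support_normed_eq] at this
    exact (mem_ball_zero_iff.mp this).le
  have hloc : LocallyIntegrable f volume := hf.locallyIntegrable hp'
  have hpt : ∀ x, ‖(∫ t, f t * w (x - t)) - f x‖ₑ ≤ ∫⁻ s, ‖f (x - s) - f x‖ₑ ∂ν := by
    intro x
    have hi : Integrable (fun t => f t * w (x - t)) volume := by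
      have hcs : HasCompactSupport (fun t => w (x - t)) := 
        φ.hasCompactSupport_normed.comp_homeomorph (Homeomorph.subLeft x)
      have := hloc.integrable_smul_left_of_hasCompactSupport (g := fun t => w (x - t))
        (φ.continuous_normed.comp (by fun_prop)) hcs
      refine this.congr (Eventually.of_forall fun t => ?_)
      simp [mul_comm]
    have hi2 : Integrable (fun s => f (x - s) * w s) volume := by
      simpa using hi.comp_sub_left x
    have e1 : ∫ t, f t * w (x - t) = ∫ s, f (x - s) * w s := by
      rw [← integral_sub_left_eq_self (fun t => f t * w (x - t)) volume x]
      simp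
    have e2 : f x = ∫ s, f x * w s := by
      rw [integral_const_mul, φ.integral_normed, mul_one]
    have e3 : (∫ t, f t * w (x - t)) - f x = ∫ s, (f (x - s) - f x) * w s := by
      rw [e1]
      conv_lhs => rw [e2]
      rw [← integral_sub hi2 (φ.integrable_normed.const_mul _)]
      congr 1
      ext s
      ring
    rw [e3]
    refine (enorm_integral_le_lintegral_enorm _).trans (le_of_eq ?_)
    have hm : Measurable (fun s => ‖f (x - s) - f x‖ₑ) := 
      ((hfm.measurable.comp (measurable_const.sub measurable_id)).sub measurable_const).enorm
    rw [hν, lintegral_withDensity_eq_lintegral_mul _ hwm hm]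
    refine lintegral_congr fun s => ?_
    rw [enorm_mul, Pi.mul_apply, mul_comm, Real.enorm_of_nonneg (φ.nonneg_normed s)]
  have hpt2 : ∀ x, ‖(∫ t, f t * w (x - t)) - f x‖ₑ ^ (p : ℝ) ≤ 
      ∫⁻ s, ‖f (x - s) - f x‖ₑ ^ (p : ℝ) ∂ν := by
    intro x
    have hm : AEStronglyMeasurable (fun s => f (x - s) - f x) ν := 
      ((hfm.measurable.comp (measurable_const.sub measurable_id)).sub 
        measurable_const).aestronglyMeasurable
    have := eLpNorm_le_eLpNorm_of_exponent_le hp' hm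
    rw [eLpNorm_one_eq_lintegral_enorm] at this
    have h2 := (hpt x).trans this
    calc _ ≤ (eLpNorm (fun s => f (x - s) - f x) p ν) ^ (p : ℝ) := by gcongr
      _ = _ := eLpNorm_nnreal_pow_eq_lintegral hp0
  rw [← ENNReal.rpow_le_rpow_iff hpr, eLpNorm_nnreal_pow_eq_lintegral hp0]
  calc _ ≤ ∫⁻ x, ∫⁻ s, ‖f (x - s) - f x‖ₑ ^ (p : ℝ) ∂ν ∂volume := lintegral_mono hpt2
    _ = ∫⁻ s, ∫⁻ x, ‖f (x - s) - f x‖ₑ ^ (p : ℝ) ∂volume ∂ν := by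
        rw [lintegral_lintegral_swap]
        apply Measurable.aemeasurable
        have h1 : Measurable (fun q : Ed d × Ed d => f (q.1 - q.2)) := 
          hfm.measurable.comp (measurable_fst.sub measurable_snd)
        exact ((h1.sub (hfm.measurable.comp measurable_fst)).enorm).pow_const _
    _ ≤ ∫⁻ s, ε ^ (p : ℝ) ∂ν := by
        apply lintegral_mono_ae
        filter_upwards [hνae] with s hs
        rw [← eLpNorm_nnreal_pow_eq_lintegral (f := fun x => f (x - s) - f x) hp0]
        gcongr
        exact h s hs
    _ = _ := by simp

/-- the standard mollifier sequence -/
def mb (d : ℕ) (n : ℕ) : ContDiffBump (0 : Ed d) := 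
  ⟨1 / (2 * (n + 1)), 1 / (n + 1), by positivity, by
    apply one_div_lt_one_div_of_lt <;> nlinarith [(Nat.cast_nonneg n : (0:ℝ) ≤ n)]⟩

/-- mollification -/
def mol (f : Ed d → ℝ) (w : Ed d → ℝ) : Ed d → ℝ := fun x => ∫ t, f t * w (x - t)

lemma moll_tendsto (p : ℝ≥0) (hp : 1 ≤ p) {f : Ed d → ℝ} (hf : MemLp f p volume) :
    Tendsto (fun n => eLpNorm (mol f ((mb d n).normed volume) - f) p volume) atTop (𝓝 0) := by
  set f' := hf.1.mk f with hf'
  have hff : f =ᵐ[volume] f' := hf.1.ae_eq_mk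
  have hfm : StronglyMeasurable f' := hf.1.stronglyMeasurable_mk
  have hfl : MemLp f' p volume := hf.ae_eq hff
  have heq : ∀ n, eLpNorm (mol f ((mb d n).normed volume) - f) p volume = 
      eLpNorm (fun x => (∫ t, f' t * (mb d n).normed volume (x - t)) - f' x) p volume := by
    intro n
    apply eLpNorm_congr_ae
    filter_upwards [hff] with x hx
    simp only [Pi.sub_apply, hx, mol]
    congr 1
    apply integral_congr_ae
    filter_upwards [hff] with t ht
    rw [ht]
  simp_rw [heq]
  rw [ENNReal.tendsto_nhds_zero]
  intro ε hε
  have h1 := (ENNReal.tendsto_nhds_zero.mp (transl p hp hfl)) ε hε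
  obtain ⟨δ, hδ, hb⟩ := Metric.eventually_nhds_iff.mp h1
  have h2 : Tendsto (fun n : ℕ => 1 / ((n : ℝ) + 1)) atTop (𝓝 0) :=
    tendsto_one_div_add_atTop_nhds_zero_nat
  filter_upwards [h2.eventually (gt_mem_nhds hδ)] with n hn
  apply moll_bound p hp hfm hfl
  intro s hs
  apply hb
  rw [dist_zero_right]
  exact lt_of_le_of_lt hs hn

lemma mol_smo {f w : Ed d → ℝ} (hf : LocallyIntegrable f volume) (hw : Smo w) 
    (hc : HasCompactSupport w) : Smo (mol f w) := by
  have := hc.contDiff_convolution_right (n := (⊤ : ℕ∞)) (ContinuousLinearMap.mul ℝ ℝ) hf hw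
  exact this

lemma mol_pderivI {f w : Ed d → ℝ} (hf : LocallyIntegrable f volume) (hw : Smo w) 
    (hc : HasCompactSupport w) (i : Fin d) : pderivI d i (mol f w) = mol f (pderivI d i w) := by
  ext x
  have hw1 : ContDiff ℝ 1 w := hw.of_le (by exact_mod_cast le_top)
  have := hc.hasFDerivAt_convolution_right (ContinuousLinearMap.mul ℝ ℝ) hf hw1 x
  have e : mol f w = convolution f w (ContinuousLinearMap.mul ℝ ℝ) volume := rfl
  unfold pderivI
  rw [e, this.fderiv, convolution_precompR_apply _ hf (hc.fderiv ℝ) 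
    (hw1.continuous_fderiv one_ne_zero)]
  rfl

lemma mol_pderivA {f w : Ed d → ℝ} (hf : LocallyIntegrable f volume) (hw : Smo w) 
    (hc : HasCompactSupport w) (α : Fin d → ℕ) : pderivA d α (mol f w) = mol f (pderivA d α w) := by
  induction α using mi_induction with
  | h0 => rw [pderivA_zero, pderivA_zero]
  | hs α i ih =>
    rw [pderivA_succ (mol_smo hf hw hc), ih, mol_pderivI hf (hw.pderivA α) (hcs_pderivA hw hc α),
      pderivA_succ hw]

end Moll

section Weak
variable {d : ℕ}

lemma weak_unique {Ω : Set (Ed d)} (hΩ : IsOpen Ω) {α : Fin d → ℕ} {u v w : Ed d → ℝ}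
    (hv : HasWeakDerivOn d Ω α u v) (hw : HasWeakDerivOn d Ω α u w) :
    v =ᵐ[volume.restrict Ω] w := by
  have key := hΩ.ae_eq_zero_of_integral_contDiff_smul_eq_zero (μ := volume) 
    (f := fun x => v x - w x) (hv.2.1.sub hw.2.1) ?_
  · rw [EventuallyEq, ae_restrict_iff' hΩ.measurableSet]
    filter_upwards [key] with x hx hxΩ
    exact sub_eq_zero.mp (hx hxΩ)
  · intro g hg hc hs
    have h1 := hv.2.2 g ⟨hg, hc, hs⟩
    have h2 := hw.2.2 g ⟨hg, hc, hs⟩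
    rw [h1] at h2
    have h3 : ∫ x in Ω, v x * g x = ∫ x in Ω, w x * g x := by
      exact mul_left_cancel₀ (pow_ne_zero _ (by norm_num)) h2
    have hi : ∀ {v : Ed d → ℝ}, LocallyIntegrableOn v Ω volume → 
        Integrable (fun x => v x * g x) (volume.restrict Ω) := by
      intro v hv
      have : IntegrableOn v (tsupport g) volume := hv.integrableOn_compact_subset hs hc
      have h4 : IntegrableOn (fun x => v x * g x) (tsupport g) volume := by
        exact this.mul_continuousOn hg.continuous.continuousOn hc
      have h5 : Integrable (fun x => v x * g x) volume := by
        rw [← integrableOn_iff_integrable_of_support_subset (s := tsupport g)]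
        · exact h4
        · intro x hx
          apply subset_tsupport
          intro h0
          exact hx (by simp [h0])
      exact h5.integrableOn
    have h6 : ∫ x, g x • (v x - w x) = ∫ x in Ω, g x • (v x - w x) := by
      rw [setIntegral_eq_integral_of_forall_compl_eq_zero]
      intro x hx
      have : g x = 0 := by
        by_contra h
        exact hx (hs (subset_tsupport _ h))
      simp [this]
    rw [h6]
    have h7 : ∀ x, g x • (v x - w x) = v x * g x - w x * g x := fun x => by
      simp only [smul_eq_mul]; ring
    simp_rw [h7]
    rw [integral_sub (hi hv.2.1) (hi hw.2.1), h3, sub_self]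

lemma weak_zero {Ω : Set (Ed d)} {u : Ed d → ℝ} (hu : LocallyIntegrableOn u Ω volume) :
    HasWeakDerivOn d Ω 0 u u := by
  refine ⟨hu, hu, fun φ _ => ?_⟩
  simp [pderivA_zero]

lemma approx_exists (p : ℝ≥0) (hp : 1 ≤ p) {m : ℕ} {Ω K : Set (Ed d)} (hΩ : IsOpen Ω) 
    (hK : IsCompact K)
    (hKΩ : K ⊆ Ω) {u : Ed d → ℝ} {D : (Fin d → ℕ) → Ed d → ℝ} (hD : IsWeakDerivFamily d Ω m u D)
    (hL : ∀ α ∈ multiIdx d m, ∀ K' ⊆ Ω, IsCompact K' → MemLp (D α) p (volume.restrict K')) :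
    ∃ un, ApproxBy p m K D un := by
  obtain ⟨δ, hδ, hδΩ⟩ := hK.exists_cthickening_subset_open hΩ hKΩ
  set K' := cthickening δ K with hK'
  have hK'c : IsCompact K' := hK.cthickening
  have hK'm : MeasurableSet K' := hK'c.measurableSet
  have hKK' : K ⊆ K' := self_subset_cthickening K
  obtain ⟨N, hN⟩ := exists_nat_one_div_lt hδ
  have hu : LocallyIntegrable (K'.indicator u) volume := by
    have h0 := hD 0 (mem_multiIdx.mpr (by rw [ord_zero]; omega))
    exact ((h0.1.integrableOn_compact_subset hδΩ hK'c).integrable_indicator hK'm).locallyIntegrable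
  set w : ℕ → Ed d → ℝ := fun n => (mb d (n + N)).normed volume with hw
  have hws : ∀ n, Smo (w n) := fun n => (mb d (n + N)).contDiff_normed
  have hwc : ∀ n, HasCompactSupport (w n) := fun n => (mb d (n + N)).hasCompactSupport_normed
  have hts : ∀ n, tsupport (w n) ⊆ closedBall 0 δ := by
    intro n
    rw [hw]
    simp only
    rw [ContDiffBump.tsupport_normed_eq]
    apply closedBall_subset_closedBall
    refine le_trans ?_ hN.le
    change 1 / (((n + N : ℕ) : ℝ) + 1) ≤ _
    push_cast
    apply one_div_le_one_div_of_le <;> nlinarith [(Nat.cast_nonneg n : (0:ℝ) ≤ n), 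
      (Nat.cast_nonneg N : (0:ℝ) ≤ N)]
  refine ⟨fun n => mol (K'.indicator u) (w n), fun n => mol_smo hu (hws n) (hwc n), 
    fun α hα => hL α hα K hKΩ hK, fun α hα => ?_⟩
  have hg : MemLp (K'.indicator (D α)) p volume := by
    rw [memLp_indicator_iff_restrict hK'm]
    exact hL α hα K' hδΩ hK'c
  have ht : Tendsto (fun n => eLpNorm (mol (K'.indicator (D α)) (w n) - K'.indicator (D α)) p volume)
      atTop (𝓝 0) := (moll_tendsto p hp hg).comp (tendsto_add_atTop_nat N)
  refine tendsto_of_tendsto_of_tendsto_of_le_of_le tendsto_const_nhds ht (fun _ => zero_le) ?_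
  intro n
  have hval : ∀ x ∈ K, pderivA d α (mol (K'.indicator u) (w n)) x = 
      mol (K'.indicator (D α)) (w n) x := by
    intro x hx
    have hmemK : ∀ t, x - t ∈ closedBall (0 : Ed d) δ → t ∈ K' := by
      intro t ht
      apply mem_cthickening_of_dist_le t x δ K hx
      rw [dist_comm, dist_eq_norm]
      simpa using ht
    rw [mol_pderivA hu (hws n) (hwc n)]
    set ψ : Ed d → ℝ := fun t => w n (x + (-1 : ℝ) • t) with hψ
    have hψs : Smo ψ := smo_affine (hws n) x (-1)
    have hψA : pderivA d α ψ = fun t => (-1) ^ ord α * pderivA d α (w n) (x + (-1 : ℝ) • t) :=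
      pderivA_affine (hws n) x (-1) α
    have hψt : tsupport ψ ⊆ K' := by
      apply closure_minimal _ hK'c.isClosed
      intro t ht
      apply hmemK
      apply hts n
      apply subset_tsupport
      have : x - t = x + (-1 : ℝ) • t := by simp [sub_eq_add_neg]
      rw [this]
      exact ht
    have htest : IsTestFun d Ω ψ := 
      ⟨hψs, hK'c.of_isClosed_subset (isClosed_tsupport _) hψt, hψt.trans hδΩ⟩
    have hwk := (hD α hα).2.2 ψ htest
    have gen : ∀ (f : Ed d → ℝ) (h : Ed d → ℝ), (∀ z, z ∉ closedBall (0 : Ed d) δ → h z = 0) → 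
        mol (K'.indicator f) h x = ∫ t in Ω, f t * h (x + (-1 : ℝ) • t) := by
      intro f h hh
      unfold mol
      rw [setIntegral_eq_integral_of_forall_compl_eq_zero]
      · congr 1
        ext t
        have : x - t = x + (-1 : ℝ) • t := by simp [sub_eq_add_neg]
        rw [← this]
        by_cases ht : t ∈ K'
        · rw [indicator_of_mem ht]
        · rw [hh (x - t) (fun h' => ht (hmemK t h'))]
          simp
      · intro t ht
        have : x - t = x + (-1 : ℝ) • t := by simp [sub_eq_add_neg]
        rw [← this, hh (x - t) (fun h' => ht (hδΩ (hmemK t h')))]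
        simp
    rw [gen u, gen (D α)]
    · have e : ∫ t in Ω, u t * pderivA d α ψ t = (-1) ^ ord α * 
          ∫ t in Ω, u t * pderivA d α (w n) (x + (-1 : ℝ) • t) := by
        rw [← integral_const_mul]
        congr 1
        ext t
        rw [hψA]
        ring
      rw [e] at hwk
      exact mul_left_cancel₀ (pow_ne_zero _ (by norm_num)) hwk
    · intro z hz
      by_contra h
      exact hz (hts n (subset_tsupport _ h))
    · intro z hz
      by_contra h
      exact hz (hts n (tsupport_pderivA (hws n) α (subset_tsupport _ h)))
  calc eLpNorm (pderivA d α (mol (K'.indicator u) (w n)) - D α) p (volume.restrict K)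
      = eLpNorm (mol (K'.indicator (D α)) (w n) - K'.indicator (D α)) p (volume.restrict K) := by
        apply eLpNorm_congr_ae
        filter_upwards [ae_restrict_mem hK.measurableSet] with x hx
        simp only [Pi.sub_apply]
        rw [hval x hx, indicator_of_mem (hKK' hx)]
    _ ≤ _ := eLpNorm_mono_measure _ Measure.restrict_le_self

lemma ApproxBy.diff {p : ℝ≥0} {m : ℕ} {S : Set (Ed d)} {D : (Fin d → ℕ) → Ed d → ℝ}
    {u : ℕ → Ed d → ℝ} (h : ApproxBy p m S D u) (hS : IsCompact S) (n : ℕ) :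
    ApproxBy p m S (fun α => pderivA d α (u n) - D α) (fun k => u n - u k) where
  smo := fun k => (h.smo n).sub (h.smo k)
  mem := fun α hα => by
    refine MemLp.sub ?_ (h.mem α hα)
    have : IsFiniteMeasure (volume.restrict S) := ⟨by simpa using hS.measure_lt_top⟩
    obtain ⟨M, hM⟩ := hS.exists_bound_of_continuousOn ((h.smo n).pderivA α).cont.continuousOn
    refine MemLp.of_bound ((h.smo n).pderivA α).cont.aestronglyMeasurable M ?_
    filter_upwards [ae_restrict_mem hS.measurableSet] with x hx using hM x hx
  lim := fun α hα => by
    refine (h.lim α hα).congr fun k => ?_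
    rw [pderivA_sub (h.smo n) (h.smo k), ← eLpNorm_neg]
    congr 1
    abel

lemma prod_conv (hd : 2 ≤ d) (m : ℕ) (p : ℝ≥0) (hp : 1 ≤ p) (h : AlgCond d m p)
    (β γ : Fin d → ℕ) (hbg : ord β + ord γ ≤ m) {S K : Set (Ed d)}
    (hK : IsCompact K) 
    (hKS : K ⊆ interior S) {D E : (Fin d → ℕ) → Ed d → ℝ} {u v : ℕ → Ed d → ℝ} 
    (hu : ApproxBy p m S D u) (hv : ApproxBy p m S E v) :
    MemLp (D β * E γ) p (volume.restrict K) ∧ 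
    Tendsto (fun n => eLpNorm (pderivA d β (u n) * pderivA d γ (v n) - D β * E γ) p 
      (volume.restrict K)) atTop (𝓝 0) := by
  have hp0 : p ≠ 0 := (zero_lt_one.trans_le hp).ne'
  have hp' : (1 : ℝ≥0∞) ≤ p := by exact_mod_cast hp
  have hpr : (0 : ℝ) < p := by exact_mod_cast (zero_lt_one.trans_le hp)
  have hβ : β ∈ multiIdx d m := mem_multiIdx.mpr (by omega)
  have hγ : γ ∈ multiIdx d m := mem_multiIdx.mpr (by omega)
  have hms : AEStronglyMeasurable (D β * E γ) (volume.restrict K) := 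
    ((hu.mem β hβ).1.mul (hv.mem γ hγ).1).mono_measure 
      (Measure.restrict_mono_set _ (hKS.trans interior_subset))
  obtain ⟨C, hC⟩ := loc_approx hd m p hp h β γ hbg
  let Q : Set (Ed d) → Prop := fun T => ∫⁻ x in T, ‖(D β * E γ) x‖ₑ ^ (p : ℝ) < ⊤ ∧ 
    Tendsto (fun n => ∫⁻ x in T, 
      ‖(pderivA d β (u n) * pderivA d γ (v n) - D β * E γ) x‖ₑ ^ (p : ℝ)) atTop (𝓝 0)
  have hQ : Q K := by
    refine hK.induction_on (p := Q) ?_ ?_ ?_ ?_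
    · simp [Q]
    · intro s t hst ht
      refine ⟨(lintegral_mono_set hst).trans_lt ht.1, tendsto_of_tendsto_of_tendsto_of_le_of_le 
        tendsto_const_nhds ht.2 (fun _ => zero_le) fun n => lintegral_mono_set hst⟩
    · intro s t hs ht
      refine ⟨(lintegral_union_le _ _ _).trans_lt (ENNReal.add_lt_top.mpr ⟨hs.1, ht.1⟩), ?_⟩
      have := hs.2.add ht.2
      rw [add_zero] at this
      exact tendsto_of_tendsto_of_tendsto_of_le_of_le 
        tendsto_const_nhds this (fun _ => zero_le) fun n => lintegral_union_le _ _ _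
    · intro y hy
      obtain ⟨r, hr, hrS⟩ := Metric.nhds_basis_closedBall.mem_iff.mp 
        (mem_interior_iff_mem_nhds.mp (hKS hy))
      refine ⟨ball y (r / 2), mem_nhdsWithin_of_mem_nhds (ball_mem_nhds _ (by positivity)), ?_⟩
      set T := ball y (r / 2) with hT
      have hTS : T ⊆ S := 
        ((ball_subset_ball (by linarith)).trans ball_subset_closedBall).trans hrS
      set κ := ENNReal.ofReal ((r ^ d)⁻¹) ^ (1 / (p : ℝ)) with hκ
      have hκt : κ ≠ ⊤ := ENNReal.rpow_ne_top_of_nonneg (by positivity) ENNReal.ofReal_ne_top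
      set R := ENNReal.ofReal (r ^ (ord β + ord γ)) with hR
      have hR0 : R ≠ 0 := (ENNReal.ofReal_pos.mpr (by positivity)).ne'
      have hRt : R ≠ ⊤ := ENNReal.ofReal_ne_top
      have hC' : ∀ (D E : (Fin d → ℕ) → Ed d → ℝ), (∃ u, ApproxBy p m (closedBall y r) D u) → 
          (∃ v, ApproxBy p m (closedBall y r) E v) → eLpNorm (D β * E γ) p (volume.restrict T) ≤
          R⁻¹ * (C * (κ * (WN p m r (closedBall y r) D * WN p m r (closedBall y r) E))) := by
        rintro D E ⟨u, hu⟩ ⟨v, hv⟩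
        have h1 := hC D E y r hr u v hu hv
        rw [← hR, ← hκ] at h1
        calc eLpNorm (D β * E γ) p (volume.restrict T)
            = R⁻¹ * (R * eLpNorm (D β * E γ) p (volume.restrict T)) := by
              rw [← mul_assoc, ENNReal.inv_mul_cancel hR0 hRt, one_mul]
          _ ≤ _ := mul_le_mul' le_rfl h1
      have hu' := hu.mono hrS
      have hv' := hv.mono hrS
      have hB : IsCompact (closedBall y r) := isCompact_closedBall y r
      have lim0 : ∀ (a b : ℕ → ℝ≥0∞) (a0 b0 : ℝ≥0∞), Tendsto a atTop (𝓝 a0) → 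
          Tendsto b atTop (𝓝 b0) → a0 ≠ ⊤ → b0 ≠ ⊤ → a0 * b0 = 0 → 
          Tendsto (fun n => R⁻¹ * (C * (κ * (a n * b n)))) atTop (𝓝 0) := by
        intro a b a0 b0 ha hb hat hbt hab
        have e : (0 : ℝ≥0∞) = R⁻¹ * (C * (κ * (a0 * b0))) := by simp [hab]
        rw [e]
        exact ENNReal.Tendsto.const_mul (ENNReal.Tendsto.const_mul (ENNReal.Tendsto.const_mul 
          (ENNReal.Tendsto.mul ha (Or.inr hbt) hb (Or.inr hat))
          (Or.inr hκt)) (Or.inr ENNReal.coe_ne_top)) (Or.inr (ENNReal.inv_ne_top.mpr hR0))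
      have hWu := hu'.WN_lt_top r
      have hWv := hv'.WN_lt_top r
      constructor
      · rw [← eLpNorm_nnreal_pow_eq_lintegral (f := D β * E γ) hp0]
        apply ENNReal.rpow_lt_top_of_nonneg hpr.le
        refine ((hC' D E ⟨u, hu'⟩ ⟨v, hv'⟩).trans_lt ?_).ne
        refine ENNReal.mul_lt_top (ENNReal.inv_ne_top.mpr hR0).lt_top (ENNReal.mul_lt_top 
          ENNReal.coe_lt_top (ENNReal.mul_lt_top hκt.lt_top (ENNReal.mul_lt_top hWu.lt_top hWv.lt_top)))
      · have hmD : AEStronglyMeasurable (D β) (volume.restrict T) := 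
          (hu.mem β hβ).1.mono_measure (Measure.restrict_mono_set _ hTS)
        have hmE : AEStronglyMeasurable (E γ) (volume.restrict T) := 
          (hv.mem γ hγ).1.mono_measure (Measure.restrict_mono_set _ hTS)
        have hmu : ∀ n, AEStronglyMeasurable (pderivA d β (u n)) (volume.restrict T) := fun n => 
          ((hu.smo n).pderivA β).cont.aestronglyMeasurable
        have hmv : ∀ n, AEStronglyMeasurable (pderivA d γ (v n)) (volume.restrict T) := fun n => 
          ((hv.smo n).pderivA γ).cont.aestronglyMeasurable
        have t1 := lim0 _ _ _ _ (hu'.tendsto_WN r) (hv'.tendsto_WN r) (by simp) (by simp) (by simp)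
        have t2 := lim0 _ _ _ _ (hu'.tendsto_WN r) tendsto_const_nhds (by simp) hWv (by simp)
        have t3 := lim0 _ _ _ _ tendsto_const_nhds (hv'.tendsto_WN r) hWu (by simp) (by simp)
        have t := (t1.add t2).add t3
        simp only [add_zero] at t
        have tt : Tendsto (fun n => eLpNorm (pderivA d β (u n) * pderivA d γ (v n) - D β * E γ) p 
          (volume.restrict T)) atTop (𝓝 0) := by
          refine tendsto_of_tendsto_of_tendsto_of_le_of_le tendsto_const_nhds t 
            (fun _ => zero_le) fun n => ?_
          have e : pderivA d β (u n) * pderivA d γ (v n) - D β * E γ = 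
            (pderivA d β (u n) - D β) * (pderivA d γ (v n) - E γ) + 
            (pderivA d β (u n) - D β) * E γ + D β * (pderivA d γ (v n) - E γ) := by ring
          simp only
          rw [e]
          refine (eLpNorm_add_le ((((hmu n).sub hmD).mul ((hmv n).sub hmE)).add 
            (((hmu n).sub hmD).mul hmE)) (hmD.mul ((hmv n).sub hmE)) hp').trans ?_
          refine add_le_add ((eLpNorm_add_le (((hmu n).sub hmD).mul ((hmv n).sub hmE)) 
            (((hmu n).sub hmD).mul hmE) hp').trans (add_le_add ?_ ?_)) ?_
          · exact hC' (fun α => pderivA d α (u n) - D α) (fun α => pderivA d α (v n) - E α) 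
              ⟨_, hu'.diff hB n⟩ ⟨_, hv'.diff hB n⟩
          · exact hC' (fun α => pderivA d α (u n) - D α) E ⟨_, hu'.diff hB n⟩ ⟨_, hv'⟩
          · exact hC' D (fun α => pderivA d α (v n) - E α) ⟨_, hu'⟩ ⟨_, hv'.diff hB n⟩
        have tp := tt.ennrpow_const (p : ℝ)
        rw [ENNReal.zero_rpow_of_pos hpr] at tp
        refine tp.congr fun n => ?_
        rw [eLpNorm_nnreal_pow_eq_lintegral hp0]
  constructor
  · refine ⟨hms, ?_⟩
    have := hQ.1
    rw [← eLpNorm_nnreal_pow_eq_lintegral hp0] at this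
    exact (ENNReal.rpow_lt_top_iff_of_pos hpr).mp this
  · have h2 := hQ.2.ennrpow_const (1 / (p : ℝ))
    rw [ENNReal.zero_rpow_of_pos (by positivity)] at h2
    refine h2.congr fun n => ?_
    rw [← eLpNorm_nnreal_pow_eq_lintegral 
      (f := pderivA d β (u n) * pderivA d γ (v n) - D β * E γ) hp0, ← ENNReal.rpow_mul,
      mul_one_div_cancel hpr.ne', ENNReal.rpow_one]

end Weak

section WeakProd
variable {d : ℕ}

/-- The Leibniz product of two families. -/
def prodFam (D E : (Fin d → ℕ) → Ed d → ℝ) (α : Fin d → ℕ) : Ed d → ℝ :=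
  ∑ q ∈ splits α, lc α q • (D q.1 * E q.2)

lemma int_lim (p : ℝ≥0) (hp : 1 ≤ p) {K Ω : Set (Ed d)} (hK : IsCompact K) (hKΩ : K ⊆ Ω)
    {f : ℕ → Ed d → ℝ} {F ψ : Ed d → ℝ} (hf : ∀ n, Continuous (f n)) 
    (hF : MemLp F p (volume.restrict K)) 
    (hψ : Continuous ψ) (hs : ∀ x ∉ K, ψ x = 0) 
    (ht : Tendsto (fun n => eLpNorm (f n - F) p (volume.restrict K)) atTop (𝓝 0)) :
    Tendsto (fun n => ∫ x, f n x * ψ x) atTop (𝓝 (∫ x in Ω, F x * ψ x)) := by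
  have hp' : (1 : ℝ≥0∞) ≤ p := by exact_mod_cast hp
  have hfin : IsFiniteMeasure (volume.restrict K) := ⟨by simpa using hK.measure_lt_top⟩
  have e1 : ∀ n, ∫ x, f n x * ψ x = ∫ x in K, f n x * ψ x := by
    intro n
    rw [setIntegral_eq_integral_of_forall_compl_eq_zero]
    intro x hx
    rw [hs x hx, mul_zero]
  have e2 : ∫ x in Ω, F x * ψ x = ∫ x in K, F x * ψ x := by
    rw [setIntegral_eq_integral_of_forall_compl_eq_zero,
      setIntegral_eq_integral_of_forall_compl_eq_zero]
    · intro x hx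
      rw [hs x hx, mul_zero]
    · intro x hx
      rw [hs x (fun h => hx (hKΩ h)), mul_zero]
  simp_rw [e1]
  rw [e2]
  obtain ⟨M, hM⟩ := hK.exists_bound_of_continuousOn hψ.continuousOn
  have hψm : ∀ᵐ x ∂(volume.restrict K), ‖ψ x‖ ≤ M := by
    filter_upwards [ae_restrict_mem hK.measurableSet] with x hx using hM x hx
  have hFi : Integrable F (volume.restrict K) := hF.integrable hp'
  refine tendsto_integral_of_L1' _ (hFi.mul_bdd (c := M) hψ.aestronglyMeasurable hψm).1 ?_ ?_
  · refine Eventually.of_forall fun n => ?_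
    exact ((hf n).mul hψ).continuousOn.integrableOn_compact hK
  · have hb : ∀ n, eLpNorm ((fun x => f n x * ψ x) - fun x => F x * ψ x) 1 (volume.restrict K) ≤
        M.toNNReal * (eLpNorm (f n - F) p (volume.restrict K) * 
          (volume.restrict K) univ ^ (1 / (1 : ℝ≥0∞).toReal - 1 / (p : ℝ≥0∞).toReal)) := by
      intro n
      have := eLpNorm_le_nnreal_smul_eLpNorm_of_ae_le_mul (μ := volume.restrict K)
        (f := (fun x => f n x * ψ x) - fun x => F x * ψ x) (g := f n - F) (c := M.toNNReal) ?_ 1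
      · refine this.trans ?_
        rw [ENNReal.smul_def, smul_eq_mul]
        gcongr
        exact eLpNorm_le_eLpNorm_mul_rpow_measure_univ hp' 
          ((hf n).aestronglyMeasurable.sub hF.1)
      · filter_upwards [hψm] with x hx
        simp only [Pi.sub_apply]
        rw [← sub_mul, nnnorm_mul, mul_comm]
        gcongr
        rw [← NNReal.coe_le_coe]
        exact hx.trans (Real.le_coe_toNNReal M)
    have hl : Tendsto (fun n => M.toNNReal * (eLpNorm (f n - F) p (volume.restrict K) * 
          (volume.restrict K) univ ^ (1 / (1 : ℝ≥0∞).toReal - 1 / (p : ℝ≥0∞).toReal)))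
          atTop (𝓝 0) := by
      have hz : (0 : ℝ≥0∞) = M.toNNReal * (0 * 
        (volume.restrict K) univ ^ (1 / (1 : ℝ≥0∞).toReal - 1 / (p : ℝ≥0∞).toReal)) := by simp
      refine Eq.subst (motive := fun t => Tendsto _ atTop (𝓝 t)) hz.symm ?_
      refine ENNReal.Tendsto.const_mul (ENNReal.Tendsto.mul_const ht (Or.inr ?_)) 
        (Or.inr ENNReal.coe_ne_top)
      apply ENNReal.rpow_ne_top_of_nonneg
      · simp only [ENNReal.toReal_one, ENNReal.coe_toReal]
        have : (1 : ℝ) ≤ p := by exact_mod_cast hp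
        rw [sub_nonneg]
        exact one_div_le_one_div_of_le one_pos this
      · exact (measure_lt_top _ _).ne
    exact tendsto_of_tendsto_of_tendsto_of_le_of_le tendsto_const_nhds hl (fun _ => zero_le) hb

lemma prodFam_conv (hd : 2 ≤ d) (m : ℕ) (p : ℝ≥0) (hp : 1 ≤ p) (h : AlgCond d m p)
    (α : Fin d → ℕ) (hα : α ∈ multiIdx d m) {S K : Set (Ed d)}
    (hK : IsCompact K) 
    (hKS : K ⊆ interior S) {D E : (Fin d → ℕ) → Ed d → ℝ} {u v : ℕ → Ed d → ℝ} 
    (hu : ApproxBy p m S D u) (hv : ApproxBy p m S E v) :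
    MemLp (prodFam D E α) p (volume.restrict K) ∧ 
    Tendsto (fun n => eLpNorm (pderivA d α (u n * v n) - prodFam D E α) p 
      (volume.restrict K)) atTop (𝓝 0) := by
  have hp' : (1 : ℝ≥0∞) ≤ p := by exact_mod_cast hp
  have hq : ∀ q ∈ splits α, ord q.1 + ord q.2 ≤ m := by
    intro q hq
    have h1 := mem_splits.mp hq
    have h2 := mem_multiIdx.mp hα
    rw [← h1, ord_add] at h2
    exact h2
  have hc := fun q (hq' : q ∈ splits α) => prod_conv hd m p hp h q.1 q.2 (hq q hq') hK hKS hu hv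
  constructor
  · unfold prodFam
    exact memLp_finsetSum' _ fun q hq' => (hc q hq').1.const_smul _
  · have hl : Tendsto (fun n => ∑ q ∈ splits α, ‖lc α q‖ₑ * eLpNorm (pderivA d q.1 (u n) * 
        pderivA d q.2 (v n) - D q.1 * E q.2) p (volume.restrict K)) atTop (𝓝 0) := by
      have hz : (0 : ℝ≥0∞) = ∑ q ∈ splits α, ‖lc α q‖ₑ * 0 := by simp
      rw [hz]
      exact tendsto_finsetSum _ fun q hq' => ENNReal.Tendsto.const_mul (hc q hq').2 (Or.inr (by simp))
    refine tendsto_of_tendsto_of_tendsto_of_le_of_le tendsto_const_nhds hl (fun _ => zero_le) ?_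
    intro n
    have e : pderivA d α (u n * v n) - prodFam D E α = ∑ q ∈ splits α, 
        lc α q • (pderivA d q.1 (u n) * pderivA d q.2 (v n) - D q.1 * E q.2) := by
      rw [leibniz α (hu.smo n) (hv.smo n), prodFam, ← Finset.sum_sub_distrib]
      simp_rw [smul_sub]
    simp only
    rw [e]
    refine (eLpNorm_sum_le (fun q hq' => ?_) hp').trans (le_of_eq ?_)
    · refine AEStronglyMeasurable.const_smul ?_ _
      exact ((((hu.smo n).pderivA _).cont.mul ((hv.smo n).pderivA _).cont).aestronglyMeasurable).sub
        (hc q hq').1.1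
    · refine Finset.sum_congr rfl fun q _ => ?_
      rw [eLpNorm_const_smul]

lemma weak_prod (hd : 2 ≤ d) (m : ℕ) (p : ℝ≥0) (hp : 1 ≤ p) (h : AlgCond d m p)
    {Ω : Set (Ed d)} (hΩ : IsOpen Ω) {u v : Ed d → ℝ} {D E : (Fin d → ℕ) → Ed d → ℝ} 
    (hD : IsWeakDerivFamily d Ω m u D) (hE : IsWeakDerivFamily d Ω m v E)
    (hLD : ∀ α ∈ multiIdx d m, ∀ K' ⊆ Ω, IsCompact K' → MemLp (D α) p (volume.restrict K'))
    (hLE : ∀ α ∈ multiIdx d m, ∀ K' ⊆ Ω, IsCompact K' → MemLp (E α) p (volume.restrict K')) :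
    IsWeakDerivFamily d Ω m (u * v) (prodFam D E) := by
  have hp' : (1 : ℝ≥0∞) ≤ p := by exact_mod_cast hp
  have h0 : (0 : Fin d → ℕ) ∈ multiIdx d m := mem_multiIdx.mpr (by rw [ord_zero]; omega)
  have hu0 : u =ᵐ[volume.restrict Ω] D 0 := weak_unique hΩ (weak_zero (hD 0 h0).1) (hD 0 h0)
  have hv0 : v =ᵐ[volume.restrict Ω] E 0 := weak_unique hΩ (weak_zero (hE 0 h0).1) (hE 0 h0)
  have happ : ∀ K ⊆ Ω, IsCompact K → ∃ S un vn, K ⊆ interior S ∧ ApproxBy p m S D un ∧ 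
      ApproxBy p m S E vn := by
    intro K hKΩ hK
    obtain ⟨S, hS, hKS, hSΩ⟩ := exists_compact_between hK hΩ hKΩ
    obtain ⟨un, hun⟩ := approx_exists p hp hΩ hS hSΩ hD hLD
    obtain ⟨vn, hvn⟩ := approx_exists p hp hΩ hS hSΩ hE hLE
    exact ⟨S, un, vn, hKS, hun, hvn⟩
  have hmem : ∀ α ∈ multiIdx d m, ∀ K ⊆ Ω, IsCompact K → 
      MemLp (prodFam D E α) p (volume.restrict K) := by
    intro α hα K hKΩ hK
    obtain ⟨S, un, vn, hKS, hun, hvn⟩ := happ K hKΩ hK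
    exact (prodFam_conv hd m p hp h α hα hK hKS hun hvn).1
  have hmem0 : ∀ K ⊆ Ω, IsCompact K → MemLp (D 0 * E 0) p (volume.restrict K) := by
    intro K hKΩ hK
    obtain ⟨S, un, vn, hKS, hun, hvn⟩ := happ K hKΩ hK
    refine (prod_conv hd m p hp h 0 0 ?_ hK hKS hun hvn).1
    rw [ord_zero]; omega
  have hloc : ∀ f : Ed d → ℝ, (∀ K ⊆ Ω, IsCompact K → MemLp f p (volume.restrict K)) → 
      LocallyIntegrableOn f Ω volume := by
    intro f hf
    rw [locallyIntegrableOn_iff hΩ.isLocallyClosed]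
    intro K hKΩ hK
    have hfin : IsFiniteMeasure (volume.restrict K) := ⟨by simpa using hK.measure_lt_top⟩
    exact (hf K hKΩ hK).integrable hp'
  have hae : (u * v) =ᵐ[volume.restrict Ω] (D 0 * E 0) := hu0.mul hv0
  have hloc0 : LocallyIntegrableOn (u * v) Ω volume := by
    refine hloc _ fun K hKΩ hK => (hmem0 K hKΩ hK).ae_eq ?_
    exact (ae_restrict_of_ae_restrict_of_subset hKΩ hae.symm)
  intro α hα
  refine ⟨hloc0, hloc _ (hmem α hα), fun φ hφ => ?_⟩
  obtain ⟨hφs, hφc, hφΩ⟩ := hφ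
  have hφs' : Smo φ := hφs
  obtain ⟨S, un, vn, hKS, hun, hvn⟩ := happ (tsupport φ) hφΩ hφc
  have c1 := prodFam_conv hd m p hp h α hα hφc hKS hun hvn
  have c0 := prod_conv hd m p hp h 0 0 (by rw [ord_zero]; omega) hφc hKS hun hvn
  simp only [pderivA_zero] at c0
  have l0 := int_lim p hp hφc hφΩ (f := fun n => un n * vn n) (ψ := pderivA d α φ)
    (fun n => ((hun.smo n).cont.mul (hvn.smo n).cont)) c0.1 (hφs'.pderivA α).cont 
    (fun x hx => by
      by_contra h
      exact hx (tsupport_pderivA hφs' α (subset_tsupport _ h))) c0.2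
  have l1 := int_lim p hp hφc hφΩ (f := fun n => pderivA d α (un n * vn n)) (ψ := φ)
    (fun n => (Smo.pderivA ((hun.smo n).mul (hvn.smo n)) α).cont) c1.1 hφs'.cont 
    (fun x hx => by
      by_contra h
      exact hx (subset_tsupport _ h)) c1.2
  have l1' := l1.const_mul ((-1 : ℝ) ^ ord α)
  have e : ∀ n, ∫ x, (un n * vn n) x * pderivA d α φ x = 
      (-1) ^ ord α * ∫ x, pderivA d α (un n * vn n) x * φ x := fun n => 
    ibp_A ((hun.smo n).mul (hvn.smo n)) hφs' hφc α
  simp_rw [e] at l0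
  have := tendsto_nhds_unique l0 l1'
  rw [← this]
  apply integral_congr_ae
  filter_upwards [hae] with x hx
  rw [hx]

end WeakProd

section Wt
variable {d : ℕ}

lemma rpow_cmp {r t : ℝ} (s : ℝ) (hr : 0 < r) (h1 : r ≤ t) (h2 : t ≤ 5 * r) :
    r ^ s ≤ 5 ^ |s| * t ^ s ∧ t ^ s ≤ 5 ^ |s| * r ^ s := by
  have ht : 0 < t := hr.trans_le h1
  have h3 : (1 : ℝ) ≤ 5 ^ |s| := Real.one_le_rpow (by norm_num) (abs_nonneg s)
  rcases le_total 0 s with hs | hs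
  · constructor
    · calc r ^ s ≤ t ^ s := Real.rpow_le_rpow hr.le h1 hs
        _ ≤ 5 ^ |s| * t ^ s := le_mul_of_one_le_left (by positivity) h3
    · calc t ^ s ≤ (5 * r) ^ s := Real.rpow_le_rpow ht.le h2 hs
        _ = _ := by rw [Real.mul_rpow (by norm_num) hr.le, abs_of_nonneg hs]
  · constructor
    · calc r ^ s ≤ (t / 5) ^ s := Real.rpow_le_rpow_of_nonpos (by positivity) (by linarith) hs
        _ = _ := by
          rw [Real.div_rpow ht.le (by norm_num), abs_of_nonpos hs, Real.rpow_neg (by norm_num)]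
          field_simp
    · calc t ^ s ≤ r ^ s := Real.rpow_le_rpow_of_nonpos hr h1 hs
        _ ≤ 5 ^ |s| * r ^ s := le_mul_of_one_le_left (by positivity) h3

/-- extended-valued Kondratiev integrand -/
def kE (ρ : Ed d → ℝ) (p : ℝ≥0) (a : ℝ) (n : ℕ) (v : Ed d → ℝ) (x : Ed d) : ℝ≥0∞ :=
  (ENNReal.ofReal (ρ x ^ ((n : ℝ) - a)) * ‖v x‖ₑ) ^ (p : ℝ)

/-- sum of the integrands -/
def gS (ρ : Ed d → ℝ) (p : ℝ≥0) (m : ℕ) (a : ℝ) (D : (Fin d → ℕ) → Ed d → ℝ) (x : Ed d) : ℝ≥0∞ :=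
  ∑ α ∈ multiIdx d m, kE ρ p a (ord α) (D α) x

/-- weight function hypotheses -/
structure GoodW (ρ : Ed d → ℝ) (Ω : Set (Ed d)) : Prop where
  lip : ∀ x y, |ρ x - ρ y| ≤ dist x y
  pos : ∀ x, x ∈ Ω ↔ 0 < ρ x

namespace GoodW
variable {ρ : Ed d → ℝ} {Ω : Set (Ed d)}

lemma cont (h : GoodW ρ Ω) : Continuous ρ := by
  have : LipschitzWith 1 ρ := LipschitzWith.of_dist_le_mul fun x y => by
    simpa [Real.dist_eq] using h.lip x y
  exact this.continuous

lemma isOpen (h : GoodW ρ Ω) : IsOpen Ω := by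
  have : Ω = {x | 0 < ρ x} := by ext x; exact h.pos x
  rw [this]
  exact isOpen_lt continuous_const h.cont

lemma near (h : GoodW ρ Ω) {x y : Ed d} {δ : ℝ} (hxy : dist x y ≤ δ) : 
    ρ y - δ ≤ ρ x ∧ ρ x ≤ ρ y + δ := by
  have := abs_le.mp ((h.lip x y).trans hxy)
  constructor <;> linarith [this.1, this.2]

lemma cB_sub (h : GoodW ρ Ω) {y : Ed d} (hy : y ∈ Ω) : closedBall y (ρ y / 2) ⊆ Ω := by
  intro x hx
  rw [h.pos] at hy ⊢
  have := (h.near (mem_closedBall.mp hx)).1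
  linarith

end GoodW

lemma vol_ball (x : Ed d) {r : ℝ} (hr : 0 < r) : volume (ball x r) = 
    ENNReal.ofReal (r ^ d) * volume (ball (0 : Ed d) 1) := by
  rw [Measure.addHaar_ball_of_pos volume x hr]
  simp

lemma avg_swap {ρ : Ed d → ℝ} {Ω : Set (Ed d)} (h : GoodW ρ Ω) (c : ℝ) 
    {f : Ed d → ℝ≥0∞} (hf : Measurable f) :
    ∫⁻ y in Ω, ENNReal.ofReal ((ρ y ^ d)⁻¹) * ∫⁻ x in ball y (c * ρ y), f x = 
    ∫⁻ x, f x * ∫⁻ y in {y | y ∈ Ω ∧ dist x y < c * ρ y}, ENNReal.ofReal ((ρ y ^ d)⁻¹) := by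
  have hΩ := h.isOpen.measurableSet
  have hwm : Measurable (fun y => ENNReal.ofReal ((ρ y ^ d)⁻¹)) := 
    ((h.cont.measurable.pow_const d).inv).ennreal_ofReal
  set W : Set (Ed d × Ed d) := {q | q.1 ∈ Ω ∧ dist q.2 q.1 < c * ρ q.1} with hW
  have hWm : MeasurableSet W := by
    apply MeasurableSet.inter
    · exact measurable_fst hΩ
    · have hc := h.cont
      have ho : IsOpen {q : Ed d × Ed d | dist q.2 q.1 < c * ρ q.1} := 
        isOpen_lt (by fun_prop) (by fun_prop)
      exact ho.measurableSet
  set k : Ed d → Ed d → ℝ≥0∞ := fun y x => 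
    W.indicator (fun q => ENNReal.ofReal ((ρ q.1 ^ d)⁻¹) * f q.2) (y, x) with hk
  have e1 : ∫⁻ y in Ω, ENNReal.ofReal ((ρ y ^ d)⁻¹) * ∫⁻ x in ball y (c * ρ y), f x = 
      ∫⁻ y, ∫⁻ x, k y x := by
    rw [← lintegral_indicator hΩ]
    refine lintegral_congr fun y => ?_
    by_cases hy : y ∈ Ω
    · rw [indicator_of_mem hy, ← lintegral_const_mul' _ _ ENNReal.ofReal_ne_top, 
        ← lintegral_indicator measurableSet_ball]
      refine lintegral_congr fun x => ?_
      simp only [hk, indicator, hW, mem_ofPred_eq, hy, true_and, mem_ball]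
    · rw [indicator_of_notMem hy]
      symm
      rw [← lintegral_zero (μ := (volume : Measure (Ed d)))]
      refine lintegral_congr fun x => ?_
      simp [hk, hW, hy]
  rw [e1, lintegral_lintegral_swap]
  · refine lintegral_congr fun x => ?_
    have hs : MeasurableSet {y | y ∈ Ω ∧ dist x y < c * ρ y} := by
      apply hΩ.inter
      have hc := h.cont
      have ho : IsOpen {y : Ed d | dist x y < c * ρ y} := isOpen_lt (by fun_prop) (by fun_prop)
      exact ho.measurableSet
    rw [← lintegral_const_mul _ hwm, ← lintegral_indicator hs]
    refine lintegral_congr fun y => ?_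
    simp only [hk, indicator, hW, mem_ofPred_eq]
    rw [mul_comm]
    rfl
  · apply Measurable.aemeasurable
    exact Measurable.indicator ((hwm.comp measurable_fst).mul (hf.comp measurable_snd)) hWm

lemma avg_lower {ρ : Ed d → ℝ} {Ω : Set (Ed d)} (h : GoodW ρ Ω)
    {f : Ed d → ℝ≥0∞} (hf : Measurable f) :
    (ENNReal.ofReal ((32 ^ d)⁻¹) * volume (ball (0 : Ed d) 1)) * ∫⁻ x in Ω, f x ≤ 
    ∫⁻ y in Ω, ENNReal.ofReal ((ρ y ^ d)⁻¹) * ∫⁻ x in ball y (1 / 8 * ρ y), f x := by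
  rw [avg_swap h _ hf, ← lintegral_const_mul _ hf]
  refine (setLIntegral_mono_ae' h.isOpen.measurableSet (Eventually.of_forall fun x hx => ?_)).trans
    (setLIntegral_le_lintegral Ω _)
  rw [mul_comm]
  gcongr
  have hx0 := (h.pos x).mp hx
  have hsub : ball x (ρ x / 16) ⊆ {y | y ∈ Ω ∧ dist x y < 1 / 8 * ρ y} := by
    intro y hy
    have h1 := mem_ball.mp hy
    have h2 := (h.near h1.le).1
    refine ⟨(h.pos y).mpr (by linarith), ?_⟩
    rw [dist_comm]
    linarith
  calc ENNReal.ofReal ((32 ^ d)⁻¹) * volume (ball (0 : Ed d) 1) 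
      = ∫⁻ y in ball x (ρ x / 16), ENNReal.ofReal (((2 * ρ x) ^ d)⁻¹) := by
        rw [setLIntegral_const, vol_ball x (by positivity), ← mul_assoc, 
          ← ENNReal.ofReal_mul (by positivity)]
        congr 2
        rw [← inv_pow, ← inv_pow, ← mul_pow]
        congr 1
        field_simp
        norm_num
    _ ≤ ∫⁻ y in ball x (ρ x / 16), ENNReal.ofReal ((ρ y ^ d)⁻¹) := by
        refine setLIntegral_mono_ae' measurableSet_ball (Eventually.of_forall fun y hy => ?_)
        apply ENNReal.ofReal_le_ofReal
        have h1 := mem_ball.mp hy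
        have h2 := h.near h1.le
        have h3 : 0 < ρ y := by linarith
        apply inv_anti₀ (by positivity)
        gcongr
        linarith
    _ ≤ _ := lintegral_mono_set hsub

lemma avg_upper {ρ : Ed d → ℝ} {Ω : Set (Ed d)} (h : GoodW ρ Ω)
    {f : Ed d → ℝ≥0∞} (hf : Measurable f) :
    ∫⁻ y in Ω, ENNReal.ofReal ((ρ y ^ d)⁻¹) * ∫⁻ x in ball y (1 / 2 * ρ y), f x ≤ 
    (ENNReal.ofReal (4 ^ d) * volume (ball (0 : Ed d) 1)) * ∫⁻ x in Ω, f x := by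
  rw [avg_swap h _ hf, ← lintegral_const_mul _ hf]
  have hΩ := h.isOpen.measurableSet
  rw [← lintegral_indicator hΩ]
  refine lintegral_mono fun x => ?_
  by_cases hx : x ∈ Ω
  · rw [indicator_of_mem hx, mul_comm]
    gcongr
    have hx0 := (h.pos x).mp hx
    have hs : ∀ y, y ∈ Ω ∧ dist x y < 1 / 2 * ρ y → ρ y < 2 * ρ x ∧ ρ x ≤ 2 * ρ y := by
      intro y hy
      have hy0 := (h.pos y).mp hy.1
      have h2 := h.near hy.2.le
      have h3 := h.near (le_of_lt (by rw [dist_comm]; exact hy.2 : dist y x < 1 / 2 * ρ y))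
      have : ρ y ≠ 2 * ρ x := by
        intro he
        have h4 := (abs_le.mp (h.lip x y)).1
        linarith [hy.2]
      exact ⟨lt_of_le_of_ne (by linarith) this, by linarith⟩
    have hsub : {y | y ∈ Ω ∧ dist x y < 1 / 2 * ρ y} ⊆ ball x (2 * ρ x) := by
      intro y hy
      have := hs y hy
      rw [mem_ball, dist_comm]
      linarith [hy.2]
    calc ∫⁻ y in {y | y ∈ Ω ∧ dist x y < 1 / 2 * ρ y}, ENNReal.ofReal ((ρ y ^ d)⁻¹)
        ≤ ∫⁻ y in {y | y ∈ Ω ∧ dist x y < 1 / 2 * ρ y}, ENNReal.ofReal (((ρ x / 2) ^ d)⁻¹) := by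
          have hm : MeasurableSet {y | y ∈ Ω ∧ dist x y < 1 / 2 * ρ y} := by
            apply hΩ.inter
            have hc := h.cont
            have ho : IsOpen {y : Ed d | dist x y < 1 / 2 * ρ y} := 
              isOpen_lt (by fun_prop) (by fun_prop)
            exact ho.measurableSet
          refine setLIntegral_mono_ae' hm (Eventually.of_forall fun y hy => ?_)
          apply ENNReal.ofReal_le_ofReal
          apply inv_anti₀ (by positivity)
          gcongr
          linarith [(hs y hy).2]
      _ ≤ ∫⁻ y in ball x (2 * ρ x), ENNReal.ofReal (((ρ x / 2) ^ d)⁻¹) := lintegral_mono_set hsub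
      _ = ENNReal.ofReal (4 ^ d) * volume (ball (0 : Ed d) 1) := by
          rw [setLIntegral_const, vol_ball x (by positivity), ← mul_assoc, 
            ← ENNReal.ofReal_mul (by positivity)]
          congr 2
          rw [← inv_pow, ← mul_pow]
          congr 1
          field_simp
          norm_num
  · have : {y | y ∈ Ω ∧ dist x y < 1 / 2 * ρ y} = ∅ := by
      rw [eq_empty_iff_forall_notMem]
      rintro y ⟨hy, hd⟩
      exact hx (h.cB_sub hy (mem_closedBall.mpr (by linarith)))
    rw [this]
    simp

lemma avg_congr {ρ : Ed d → ℝ} {Ω : Set (Ed d)} (h : GoodW ρ Ω) {c : ℝ} (hc : c ≤ 1 / 2)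
    {f g : Ed d → ℝ≥0∞} (hfg : f =ᵐ[volume.restrict Ω] g) :
    ∫⁻ y in Ω, ENNReal.ofReal ((ρ y ^ d)⁻¹) * ∫⁻ x in ball y (c * ρ y), f x =
    ∫⁻ y in Ω, ENNReal.ofReal ((ρ y ^ d)⁻¹) * ∫⁻ x in ball y (c * ρ y), g x := by
  refine setLIntegral_congr_fun h.isOpen.measurableSet fun y hy => ?_
  congr 1
  apply lintegral_congr_ae
  refine ae_restrict_of_ae_restrict_of_subset (t := Ω) ?_ hfg
  refine Subset.trans ?_ (h.cB_sub hy)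
  refine (ball_subset_closedBall).trans (closedBall_subset_closedBall ?_)
  have := (h.pos y).mp hy
  nlinarith

end Wt

section Glob
variable {d : ℕ}

lemma WN_pow (p : ℝ≥0) (hp : 1 ≤ p) (m : ℕ) (r : ℝ) (S : Set (Ed d)) 
    (D : (Fin d → ℕ) → Ed d → ℝ) :
    (WN p m r S D) ^ (p : ℝ) ≤ ((multiIdx d m).card : ℝ≥0∞) ^ ((p : ℝ) - 1) * 
      ∑ α ∈ multiIdx d m, ENNReal.ofReal (r ^ ord α) ^ (p : ℝ) * 
        ∫⁻ x in S, ‖D α x‖ₑ ^ (p : ℝ) := by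
  have hp0 : p ≠ 0 := (zero_lt_one.trans_le hp).ne'
  have hp1 : (1 : ℝ) ≤ p := by exact_mod_cast hp
  unfold WN
  refine (ENNReal.rpow_sum_le_const_mul_sum_rpow _ _ hp1).trans (le_of_eq ?_)
  congr 1
  refine Finset.sum_congr rfl fun α _ => ?_
  rw [ENNReal.mul_rpow_of_nonneg _ _ (by positivity), eLpNorm_nnreal_pow_eq_lintegral hp0]

lemma abs_le_exp {n m : ℕ} (hn : n ≤ m) (a : ℝ) : 
    (5 : ℝ) ^ |(n : ℝ) - a| ≤ 5 ^ ((m : ℝ) + |a|) := by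
  apply Real.rpow_le_rpow_of_exponent_le (by norm_num)
  have h1 : |(n : ℝ) - a| ≤ |(n : ℝ)| + |a| := abs_sub _ _
  have h2 : (n : ℝ) ≤ m := by exact_mod_cast hn
  rw [Nat.abs_cast] at h1
  linarith

lemma WN_le {ρ : Ed d → ℝ} {Ω : Set (Ed d)} (h : GoodW ρ Ω) (p : ℝ≥0) (hp : 1 ≤ p) (m : ℕ) 
    (a : ℝ) : ∃ C : ℝ≥0, ∀ (D : (Fin d → ℕ) → Ed d → ℝ) (y : Ed d), y ∈ Ω → 
    (WN p m (ρ y / 4) (closedBall y (ρ y / 4)) D) ^ (p : ℝ) ≤ 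
      C * (ENNReal.ofReal ((ρ y / 4) ^ a) ^ (p : ℝ) * ∫⁻ x in ball y (1 / 2 * ρ y), gS ρ p m a D x) := by
  have hp1 : (1 : ℝ) ≤ p := by exact_mod_cast hp
  have hpr : (0 : ℝ) ≤ p := by positivity
  set M : ℝ≥0∞ := ENNReal.ofReal (5 ^ ((m : ℝ) + |a|)) with hM
  set N : ℝ≥0∞ := ((multiIdx d m).card : ℝ≥0∞) with hN
  set C : ℝ≥0∞ := N ^ ((p : ℝ) - 1) * (N * M ^ (p : ℝ)) with hC
  have hMt : M ^ (p : ℝ) ≠ ⊤ := ENNReal.rpow_ne_top_of_nonneg hpr ENNReal.ofReal_ne_top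
  have hCt : C ≠ ⊤ := by
    refine ENNReal.mul_ne_top (ENNReal.rpow_ne_top_of_nonneg (by linarith) (by simp [hN])) 
      (ENNReal.mul_ne_top (by simp [hN]) hMt)
  refine ⟨C.toNNReal, fun D y hy => ?_⟩
  rw [ENNReal.coe_toNNReal hCt]
  have hy0 := (h.pos y).mp hy
  set r := ρ y / 4 with hr
  have hr0 : 0 < r := by positivity
  refine (WN_pow p hp m r _ D).trans ?_
  rw [hC, mul_assoc]
  refine mul_le_mul' le_rfl ?_
  rw [mul_assoc, hN, ← nsmul_eq_mul]
  refine Finset.sum_le_card_nsmul _ _ _ fun α hα => ?_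
  set s : ℝ := (ord α : ℝ) - a with hs
  rw [← lintegral_const_mul' _ _ (ENNReal.rpow_ne_top_of_nonneg hpr ENNReal.ofReal_ne_top), 
    ← mul_assoc, ← lintegral_const_mul' _ _ (ENNReal.mul_ne_top hMt 
      (ENNReal.rpow_ne_top_of_nonneg hpr ENNReal.ofReal_ne_top))]
  refine (setLIntegral_mono_ae' measurableSet_closedBall (Eventually.of_forall fun x hx => ?_)).trans
    (lintegral_mono_set (closedBall_subset_ball (by linarith)))
  have hnear := h.near (mem_closedBall.mp hx)
  have h1 : kE ρ p a (ord α) (D α) x ≤ gS ρ p m a D x := 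
    Finset.single_le_sum (f := fun α => kE ρ p a (ord α) (D α) x) (fun _ _ => zero_le) hα
  refine le_trans ?_ (mul_le_mul' le_rfl h1)
  unfold kE
  rw [← ENNReal.mul_rpow_of_nonneg _ _ hpr, ← ENNReal.mul_rpow_of_nonneg _ _ hpr, 
    ← ENNReal.mul_rpow_of_nonneg _ _ hpr]
  apply ENNReal.rpow_le_rpow _ hpr
  rw [← mul_assoc]
  gcongr
  rw [hM, ← ENNReal.ofReal_mul (by positivity), ← ENNReal.ofReal_mul (by positivity)]
  apply ENNReal.ofReal_le_ofReal
  have h2 := (rpow_cmp (r := r) (t := ρ x) s hr0 (by linarith [hnear.1]) (by linarith [hnear.2])).1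
  have h3 := abs_le_exp (mem_multiIdx.mp hα) a
  have h4 : r ^ ord α = r ^ a * r ^ s := by
    rw [← Real.rpow_add hr0, hs, ← Real.rpow_natCast]
    congr 1
    ring
  have h5 : 0 < ρ x := by linarith [hnear.1]
  rw [h4]
  calc r ^ a * r ^ s ≤ r ^ a * (5 ^ |s| * ρ x ^ s) := by gcongr
    _ ≤ r ^ a * (5 ^ ((m : ℝ) + |a|) * ρ x ^ s) := by gcongr
    _ = _ := by ring

lemma ptwise (hd : 2 ≤ d) (m : ℕ) (p : ℝ≥0) (hp : 1 ≤ p) (halg : AlgCond d m p)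
    {ρ : Ed d → ℝ} {Ω : Set (Ed d)} (h : GoodW ρ Ω) (a₁ a₂ : ℝ)
    (β γ : Fin d → ℕ) (hbg : ord β + ord γ ≤ m) : ∃ C : ℝ≥0, 
    ∀ (D E : (Fin d → ℕ) → Ed d → ℝ), ∀ y ∈ Ω, 
      (∃ u, ApproxBy p m (closedBall y (ρ y / 4)) D u) → 
      (∃ v, ApproxBy p m (closedBall y (ρ y / 4)) E v) → 
      ∫⁻ x in ball y (1 / 8 * ρ y), kE ρ p (a₁ + a₂ - d / p) (ord β + ord γ) (D β * E γ) x ≤ 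
        C * ((∫⁻ x in ball y (1 / 2 * ρ y), gS ρ p m a₁ D x) * 
          (∫⁻ x in ball y (1 / 2 * ρ y), gS ρ p m a₂ E x)) := by
  obtain ⟨C, hC⟩ := loc_approx hd m p hp halg β γ hbg
  obtain ⟨C₁, hC₁⟩ := WN_le h p hp m a₁
  obtain ⟨C₂, hC₂⟩ := WN_le h p hp m a₂
  have hp0 : p ≠ 0 := (zero_lt_one.trans_le hp).ne'
  have hpr : (0 : ℝ) ≤ p := by positivity
  have hpr' : (0 : ℝ) < p := by exact_mod_cast (zero_lt_one.trans_le hp)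
  set a := a₁ + a₂ - d / p with ha
  set M : ℝ≥0∞ := ENNReal.ofReal (5 ^ ((m : ℝ) + |a|)) with hM
  have hMt : M ≠ ⊤ := ENNReal.ofReal_ne_top
  set C' : ℝ≥0∞ := M ^ (p : ℝ) * ((C : ℝ≥0∞) ^ (p : ℝ) * (C₁ * C₂)) with hC'
  have hC't : C' ≠ ⊤ := ENNReal.mul_ne_top (ENNReal.rpow_ne_top_of_nonneg hpr hMt)
    (ENNReal.mul_ne_top (ENNReal.rpow_ne_top_of_nonneg hpr ENNReal.coe_ne_top) 
      (ENNReal.mul_ne_top ENNReal.coe_ne_top ENNReal.coe_ne_top))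
  refine ⟨C'.toNNReal, fun D E y hy ⟨u, hu⟩ ⟨v, hv⟩ => ?_⟩
  rw [ENNReal.coe_toNNReal hC't]
  have hy0 := (h.pos y).mp hy
  have h1 := hC₁ D y hy
  have h2 := hC₂ E y hy
  set r := ρ y / 4 with hr
  have hr0 : 0 < r := by positivity
  have h3 := hC D E y r hr0 u v hu hv
  have hball : ball y (1 / 8 * ρ y) = ball y (r / 2) := by
    congr 1
    rw [hr]; ring
  rw [hball]
  set G₁ := ∫⁻ x in ball y (1 / 2 * ρ y), gS ρ p m a₁ D x
  set G₂ := ∫⁻ x in ball y (1 / 2 * ρ y), gS ρ p m a₂ E x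
  set W₁ := WN p m r (closedBall y r) D
  set W₂ := WN p m r (closedBall y r) E
  set n := ord β + ord γ with hn
  set X := eLpNorm (D β * E γ) p (volume.restrict (ball y (r / 2))) with hX
  set t := ENNReal.ofReal (r ^ (-a)) with ht
  have s1 : ∫⁻ x in ball y (r / 2), kE ρ p a n (D β * E γ) x ≤ 
      (M * (t * (ENNReal.ofReal (r ^ n) * X))) ^ (p : ℝ) := by
    rw [show M * (t * (ENNReal.ofReal (r ^ n) * X)) = (M * (t * ENNReal.ofReal (r ^ n))) * X by ring,
      ENNReal.mul_rpow_of_nonneg _ _ hpr, hX, eLpNorm_nnreal_pow_eq_lintegral hp0, 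
      ← lintegral_const_mul' _ _ (ENNReal.rpow_ne_top_of_nonneg hpr (ENNReal.mul_ne_top hMt 
        (ENNReal.mul_ne_top ENNReal.ofReal_ne_top ENNReal.ofReal_ne_top)))]
    refine setLIntegral_mono_ae' measurableSet_ball (Eventually.of_forall fun x hx => ?_)
    have hnear := h.near (mem_ball.mp hx).le
    unfold kE
    rw [← ENNReal.mul_rpow_of_nonneg _ _ hpr]
    apply ENNReal.rpow_le_rpow _ hpr
    gcongr
    rw [hM, ← ENNReal.ofReal_mul (by positivity), ← ENNReal.ofReal_mul (by positivity)]
    apply ENNReal.ofReal_le_ofReal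
    have h2 := (rpow_cmp (r := r) (t := ρ x) ((n : ℝ) - a) hr0 (by linarith [hnear.1]) 
      (by linarith [hnear.2])).2
    have h3 := abs_le_exp hbg a
    have h4 : r ^ (-a) * r ^ n = r ^ ((n : ℝ) - a) := by
      rw [← Real.rpow_natCast, ← Real.rpow_add hr0]
      congr 1
      ring
    rw [h4]
    calc ρ x ^ ((n : ℝ) - a) ≤ 5 ^ |(n : ℝ) - a| * r ^ ((n : ℝ) - a) := h2
      _ ≤ _ := by gcongr
  set κ := ENNReal.ofReal ((r ^ d)⁻¹) ^ (1 / (p : ℝ)) with hκ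
  have hone : t * (κ * (ENNReal.ofReal (r ^ a₁) * ENNReal.ofReal (r ^ a₂))) = 1 := by
    have hκ' : κ = ENNReal.ofReal (r ^ (-(d : ℝ) / p)) := by
      rw [hκ, ENNReal.ofReal_rpow_of_nonneg (by positivity) (by positivity)]
      congr 1
      rw [← Real.rpow_natCast, ← Real.rpow_neg hr0.le, ← Real.rpow_mul hr0.le]
      congr 1
      ring
    rw [hκ', ht, ← ENNReal.ofReal_mul (by positivity), ← ENNReal.ofReal_mul (by positivity), 
      ← ENNReal.ofReal_mul (by positivity), ← Real.rpow_add hr0, ← Real.rpow_add hr0,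
      ← Real.rpow_add hr0]
    have : -a + (-(d : ℝ) / p + (a₁ + a₂)) = 0 := by rw [ha]; ring
    rw [this, Real.rpow_zero, ENNReal.ofReal_one]
  calc _ ≤ _ := s1
    _ ≤ (M * (t * (C * (κ * (W₁ * W₂))))) ^ (p : ℝ) := by
        apply ENNReal.rpow_le_rpow _ hpr
        exact mul_le_mul' le_rfl (mul_le_mul' le_rfl h3)
    _ = M ^ (p : ℝ) * (t ^ (p : ℝ) * ((C : ℝ≥0∞) ^ (p : ℝ) * (κ ^ (p : ℝ) * 
          (W₁ ^ (p : ℝ) * W₂ ^ (p : ℝ))))) := by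
        simp only [ENNReal.mul_rpow_of_nonneg _ _ hpr]
    _ ≤ M ^ (p : ℝ) * (t ^ (p : ℝ) * ((C : ℝ≥0∞) ^ (p : ℝ) * (κ ^ (p : ℝ) * 
          ((C₁ * (ENNReal.ofReal (r ^ a₁) ^ (p : ℝ) * G₁)) * 
          (C₂ * (ENNReal.ofReal (r ^ a₂) ^ (p : ℝ) * G₂)))))) := by gcongr
    _ = C' * (G₁ * G₂) * (t * (κ * (ENNReal.ofReal (r ^ a₁) * ENNReal.ofReal (r ^ a₂)))) ^ (p : ℝ) := by
        simp only [ENNReal.mul_rpow_of_nonneg _ _ hpr, hC']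
        ring
    _ = _ := by rw [hone, ENNReal.one_rpow, mul_one]

lemma kE_aemeas {ρ : Ed d → ℝ} {Ω : Set (Ed d)} (h : GoodW ρ Ω) (p : ℝ≥0) (a : ℝ) (n : ℕ) 
    {v : Ed d → ℝ} (hv : AEStronglyMeasurable v (volume.restrict Ω)) : 
    AEMeasurable (kE ρ p a n v) (volume.restrict Ω) := by
  unfold kE
  exact ((((h.cont.measurable.pow_const _).ennreal_ofReal).aemeasurable).mul hv.enorm).pow_const _

lemma globest (hd : 2 ≤ d) (m : ℕ) (p : ℝ≥0) (hp : 1 ≤ p) (halg : AlgCond d m p)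
    {ρ : Ed d → ℝ} {Ω : Set (Ed d)} (h : GoodW ρ Ω) (a₁ a₂ : ℝ)
    (β γ : Fin d → ℕ) (hbg : ord β + ord γ ≤ m) : ∃ C : ℝ≥0, 
    ∀ (D E : (Fin d → ℕ) → Ed d → ℝ), 
      (∀ α ∈ multiIdx d m, AEStronglyMeasurable (D α) (volume.restrict Ω)) → 
      (∀ α ∈ multiIdx d m, AEStronglyMeasurable (E α) (volume.restrict Ω)) → 
      (∀ K ⊆ Ω, IsCompact K → ∃ u, ApproxBy p m K D u) → 
      (∀ K ⊆ Ω, IsCompact K → ∃ v, ApproxBy p m K E v) → 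
      ∫⁻ x in Ω, gS ρ p m a₂ E x ≠ ⊤ → 
      ∫⁻ x in Ω, kE ρ p (a₁ + a₂ - d / p) (ord β + ord γ) (D β * E γ) x ≤ 
        C * ((∫⁻ x in Ω, gS ρ p m a₁ D x) * (∫⁻ x in Ω, gS ρ p m a₂ E x)) := by
  obtain ⟨C, hC⟩ := ptwise hd m p hp halg h a₁ a₂ β γ hbg
  set V := volume (ball (0 : Ed d) 1) with hV
  have hVt : V ≠ ⊤ := measure_ball_lt_top.ne
  have hV0 : V ≠ 0 := (measure_ball_pos volume _ one_pos).ne'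
  set cl := ENNReal.ofReal ((32 ^ d)⁻¹) * V with hcl
  set cu := ENNReal.ofReal (4 ^ d) * V with hcu
  have hcl0 : cl ≠ 0 := mul_ne_zero (ENNReal.ofReal_pos.mpr (by positivity)).ne' hV0
  have hclt : cl ≠ ⊤ := ENNReal.mul_ne_top ENNReal.ofReal_ne_top hVt
  have hcut : cu ≠ ⊤ := ENNReal.mul_ne_top ENNReal.ofReal_ne_top hVt
  have hCt : cl⁻¹ * (C * cu) ≠ ⊤ := ENNReal.mul_ne_top (ENNReal.inv_ne_top.mpr hcl0) 
    (ENNReal.mul_ne_top ENNReal.coe_ne_top hcut)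
  refine ⟨(cl⁻¹ * (C * cu)).toNNReal, fun D E hDm hEm hDa hEa hfin => ?_⟩
  rw [ENNReal.coe_toNNReal hCt]
  set f := kE ρ p (a₁ + a₂ - d / p) (ord β + ord γ) (D β * E γ) with hf
  set g := gS ρ p m a₁ D with hg
  set Z := ∫⁻ x in Ω, gS ρ p m a₂ E x with hZ
  have hfm : AEMeasurable f (volume.restrict Ω) := kE_aemeas h p _ _ 
    ((hDm β (mem_multiIdx.mpr (by omega))).mul (hEm γ (mem_multiIdx.mpr (by omega))))
  have hgm : AEMeasurable g (volume.restrict Ω) := 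
    Finset.aemeasurable_fun_sum _ fun α hα => kE_aemeas h p _ _ (hDm α hα)
  have hl := avg_lower h hfm.measurable_mk
  rw [← avg_congr h (by norm_num) hfm.ae_eq_mk, ← lintegral_congr_ae hfm.ae_eq_mk, ← hcl] at hl
  have hu := avg_upper h hgm.measurable_mk
  rw [← avg_congr h (by norm_num) hgm.ae_eq_mk, ← lintegral_congr_ae hgm.ae_eq_mk, ← hcu] at hu
  have key : cl * ∫⁻ x in Ω, f x ≤ C * cu * ((∫⁻ x in Ω, g x) * Z) := by
    calc _ ≤ _ := hl
      _ ≤ ∫⁻ y in Ω, (C * Z) * (ENNReal.ofReal ((ρ y ^ d)⁻¹) * ∫⁻ x in ball y (1 / 2 * ρ y), g x) := by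
          refine setLIntegral_mono_ae' h.isOpen.measurableSet (Eventually.of_forall fun y hy => ?_)
          have hy0 := (h.pos y).mp hy
          have hsub : closedBall y (ρ y / 4) ⊆ Ω := 
            (closedBall_subset_closedBall (by linarith)).trans (h.cB_sub hy)
          have hsub2 : ball y (1 / 2 * ρ y) ⊆ Ω := 
            (ball_subset_closedBall.trans (closedBall_subset_closedBall (by linarith))).trans 
              (h.cB_sub hy)
          have h1 := hC D E y hy (hDa _ hsub (isCompact_closedBall _ _)) 
            (hEa _ hsub (isCompact_closedBall _ _))
          calc _ ≤ ENNReal.ofReal ((ρ y ^ d)⁻¹) * (C * ((∫⁻ x in ball y (1 / 2 * ρ y), g x) * 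
                  (∫⁻ x in ball y (1 / 2 * ρ y), gS ρ p m a₂ E x))) := mul_le_mul' le_rfl h1
            _ ≤ ENNReal.ofReal ((ρ y ^ d)⁻¹) * (C * ((∫⁻ x in ball y (1 / 2 * ρ y), g x) * Z)) := by
                gcongr
                exact lintegral_mono_set hsub2
            _ = _ := by ring
      _ = (C * Z) * ∫⁻ y in Ω, (ENNReal.ofReal ((ρ y ^ d)⁻¹) * ∫⁻ x in ball y (1 / 2 * ρ y), g x) :=
          lintegral_const_mul' _ _ (ENNReal.mul_ne_top ENNReal.coe_ne_top hfin)
      _ ≤ (C * Z) * (cu * ∫⁻ x in Ω, g x) := mul_le_mul' le_rfl hu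
      _ = _ := by ring
  calc ∫⁻ x in Ω, f x = cl⁻¹ * (cl * ∫⁻ x in Ω, f x) := by
        rw [← mul_assoc, ENNReal.inv_mul_cancel hcl0 hclt, one_mul]
    _ ≤ cl⁻¹ * (C * cu * ((∫⁻ x in Ω, g x) * Z)) := mul_le_mul' le_rfl key
    _ = _ := by ring

lemma memLp_loc {ρ : Ed d → ℝ} {Ω : Set (Ed d)} (h : GoodW ρ Ω) (p : ℝ≥0) (hp : 1 ≤ p) (a : ℝ) 
    (n : ℕ) {v : Ed d → ℝ} (hv : AEStronglyMeasurable v (volume.restrict Ω)) 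
    (hfin : ∫⁻ x in Ω, kE ρ p a n v x ≠ ⊤) {K : Set (Ed d)} (hKΩ : K ⊆ Ω) (hK : IsCompact K) :
    MemLp v p (volume.restrict K) := by
  have hp0 : p ≠ 0 := (zero_lt_one.trans_le hp).ne'
  have hpr : (0 : ℝ) < p := by exact_mod_cast (zero_lt_one.trans_le hp)
  refine ⟨hv.mono_measure (Measure.restrict_mono_set _ hKΩ), ?_⟩
  rw [← ENNReal.rpow_lt_top_iff_of_pos hpr, eLpNorm_nnreal_pow_eq_lintegral hp0]
  have hcont : ContinuousOn (fun x => ρ x ^ (-((n : ℝ) - a))) K := by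
    apply h.cont.continuousOn.rpow_const
    intro x hx
    exact Or.inl ((h.pos x).mp (hKΩ hx)).ne'
  obtain ⟨M, hM⟩ := hK.exists_bound_of_continuousOn hcont
  have hMt : ENNReal.ofReal M ^ (p : ℝ) ≠ ⊤ := 
    ENNReal.rpow_ne_top_of_nonneg hpr.le ENNReal.ofReal_ne_top
  calc ∫⁻ x in K, ‖v x‖ₑ ^ (p : ℝ) ≤ ∫⁻ x in K, ENNReal.ofReal M ^ (p : ℝ) * kE ρ p a n v x := by
        refine setLIntegral_mono_ae' hK.measurableSet (Eventually.of_forall fun x hx => ?_)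
        unfold kE
        rw [← ENNReal.mul_rpow_of_nonneg _ _ hpr.le]
        apply ENNReal.rpow_le_rpow _ hpr.le
        have hx0 := (h.pos x).mp (hKΩ hx)
        have h1 := hM x hx
        rw [Real.norm_of_nonneg (by positivity)] at h1
        have hM0 : 0 ≤ M := le_trans (by positivity) h1
        rw [← mul_assoc, ← ENNReal.ofReal_mul hM0]
        have h2 : 1 ≤ M * ρ x ^ ((n : ℝ) - a) := by
          calc (1 : ℝ) = ρ x ^ (-((n : ℝ) - a)) * ρ x ^ ((n : ℝ) - a) := by
                rw [← Real.rpow_add hx0]; simp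
            _ ≤ _ := by gcongr
        calc ‖v x‖ₑ = 1 * ‖v x‖ₑ := (one_mul _).symm
          _ ≤ _ := by
            gcongr
            rw [← ENNReal.ofReal_one]
            exact ENNReal.ofReal_le_ofReal h2
    _ = ENNReal.ofReal M ^ (p : ℝ) * ∫⁻ x in K, kE ρ p a n v x := lintegral_const_mul' _ _ hMt
    _ < ⊤ := by
        refine ENNReal.mul_lt_top hMt.lt_top ?_
        exact (lintegral_mono_set hKΩ).trans_lt hfin.lt_top

end Glob

section Final
variable {d : ℕ}

lemma goodW_model (ℓ : ℕ) (hl : ℓ < d) : GoodW (rhoModel d ℓ) (ModelDomain d ℓ) := by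
  let P : Ed d → Ed d := fun x => WithLp.toLp 2 fun i => if (i : ℕ) < d - ℓ then x i else 0
  have hP : ∀ x, Real.sqrt (∑ i ∈ Finset.univ.filter (fun i : Fin d => (i : ℕ) < d - ℓ), (x i) ^ 2) 
      = ‖P x‖ := by
    intro x
    rw [EuclideanSpace.norm_eq, Finset.sum_filter]
    congr 1
    refine Finset.sum_congr rfl fun i _ => ?_
    by_cases h : (i : ℕ) < d - ℓ <;> simp [P, h]
  have hsub : ∀ x y, P x - P y = P (x - y) := by
    intro x y
    ext i
    by_cases h : (i : ℕ) < d - ℓ <;> simp [P, h]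
  have hle : ∀ z, ‖P z‖ ≤ ‖z‖ := by
    intro z
    rw [EuclideanSpace.norm_eq, EuclideanSpace.norm_eq]
    apply Real.sqrt_le_sqrt
    refine Finset.sum_le_sum fun i _ => ?_
    by_cases h : (i : ℕ) < d - ℓ <;> simp [P, h, sq_nonneg]
  constructor
  · intro x y
    unfold rhoModel
    rw [hP, hP]
    have h1 := abs_min_sub_min_le_max 1 ‖P x‖ 1 ‖P y‖
    have h2 : |‖P x‖ - ‖P y‖| ≤ dist x y := by
      refine (abs_norm_sub_norm_le _ _).trans ?_
      rw [hsub, dist_eq_norm]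
      exact hle _
    refine h1.trans (max_le ?_ h2)
    simp
  · intro x
    unfold rhoModel
    rw [hP, lt_min_iff, norm_pos_iff]
    have : x ∈ ModelDomain d ℓ ↔ ¬ ∀ i : Fin d, (i : ℕ) < d - ℓ → x i = 0 := Iff.rfl
    rw [this]
    simp only [zero_lt_one, true_and, ne_eq]
    apply not_congr
    constructor
    · intro h
      ext i
      by_cases hi : (i : ℕ) < d - ℓ
      · simp [P, h i hi]
      · simp [P, hi]
    · intro h i hi
      have := congrArg (fun z : Ed d => z i) h
      simpa [P, hi] using this

lemma ofReal_kInt {ρ : Ed d → ℝ} (p : ℝ≥0) (a : ℝ) (α : Fin d → ℕ) (v : Ed d → ℝ) 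
    {x : Ed d} (hx : 0 < ρ x) :
    ENNReal.ofReal (kIntegrand d ρ a p α v x) = kE ρ p a (ord α) v x := by
  unfold kIntegrand kE
  rw [← ENNReal.ofReal_rpow_of_nonneg (by positivity) p.coe_nonneg, ENNReal.ofReal_mul (by positivity), 
    Real.enorm_eq_ofReal_abs]

lemma kInt_nonneg {ρ : Ed d → ℝ} (p : ℝ≥0) (a : ℝ) (α : Fin d → ℕ) (v : Ed d → ℝ) 
    {x : Ed d} (hx : 0 < ρ x) : 0 ≤ kIntegrand d ρ a p α v x := by
  unfold kIntegrand
  positivity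

lemma kInt_aesm {ρ : Ed d → ℝ} {Ω : Set (Ed d)} (h : GoodW ρ Ω) (p : ℝ≥0) (a : ℝ) (α : Fin d → ℕ)
    {v : Ed d → ℝ} (hv : AEStronglyMeasurable v (volume.restrict Ω)) :
    AEStronglyMeasurable (kIntegrand d ρ a p α v) (volume.restrict Ω) := by
  unfold kIntegrand
  have h1 : AEMeasurable (fun x => |v x|) (volume.restrict Ω) := hv.aemeasurable.abs
  exact ((((h.cont.measurable.pow_const _)).aemeasurable.mul h1).pow_const _).aestronglyMeasurable

lemma lint_kInt {ρ : Ed d → ℝ} {Ω : Set (Ed d)} (h : GoodW ρ Ω) (p : ℝ≥0) (a : ℝ) (α : Fin d → ℕ)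
    (v : Ed d → ℝ) :
    ∫⁻ x in Ω, ENNReal.ofReal (kIntegrand d ρ a p α v x) = ∫⁻ x in Ω, kE ρ p a (ord α) v x := by
  apply lintegral_congr_ae
  filter_upwards [ae_restrict_mem h.isOpen.measurableSet] with x hx
  exact ofReal_kInt p a α v ((h.pos x).mp hx)

lemma kInt_ae_nonneg {ρ : Ed d → ℝ} {Ω : Set (Ed d)} (h : GoodW ρ Ω) (p : ℝ≥0) (a : ℝ) 
    (α : Fin d → ℕ) (v : Ed d → ℝ) : 0 ≤ᵐ[volume.restrict Ω] kIntegrand d ρ a p α v := by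
  filter_upwards [ae_restrict_mem h.isOpen.measurableSet] with x hx
  exact kInt_nonneg p a α v ((h.pos x).mp hx)

lemma kInt_integrable {ρ : Ed d → ℝ} {Ω : Set (Ed d)} (h : GoodW ρ Ω) (p : ℝ≥0) (a : ℝ) 
    (α : Fin d → ℕ) {v : Ed d → ℝ} (hv : AEStronglyMeasurable v (volume.restrict Ω)) :
    IntegrableOn (kIntegrand d ρ a p α v) Ω volume ↔ ∫⁻ x in Ω, kE ρ p a (ord α) v x ≠ ⊤ := by
  rw [← lint_kInt h]
  exact (lintegral_ofReal_ne_top_iff_integrable (kInt_aesm h p a α hv) (kInt_ae_nonneg h p a α v)).symm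

lemma kInt_integral {ρ : Ed d → ℝ} {Ω : Set (Ed d)} (h : GoodW ρ Ω) (p : ℝ≥0) (a : ℝ) 
    (α : Fin d → ℕ) {v : Ed d → ℝ} (hv : AEStronglyMeasurable v (volume.restrict Ω)) :
    ∫ x in Ω, kIntegrand d ρ a p α v x = (∫⁻ x in Ω, kE ρ p a (ord α) v x).toReal := by
  rw [← lint_kInt h]
  exact integral_eq_lintegral_of_nonneg_ae (kInt_ae_nonneg h p a α v) (kInt_aesm h p a α hv)

lemma lint_gS {ρ : Ed d → ℝ} {Ω : Set (Ed d)} (h : GoodW ρ Ω) (p : ℝ≥0) (m : ℕ) (a : ℝ) 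
    {D : (Fin d → ℕ) → Ed d → ℝ} 
    (hD : ∀ α ∈ multiIdx d m, AEStronglyMeasurable (D α) (volume.restrict Ω)) :
    ∫⁻ x in Ω, gS ρ p m a D x = ∑ α ∈ multiIdx d m, ∫⁻ x in Ω, kE ρ p a (ord α) (D α) x := by
  unfold gS
  exact lintegral_finsetSum' _ fun α hα => kE_aemeas h p a _ (hD α hα)

lemma fam_aesm {Ω : Set (Ed d)} {m : ℕ} (hΩ : IsOpen Ω) {u : Ed d → ℝ}
    {D : (Fin d → ℕ) → Ed d → ℝ} (hD : IsWeakDerivFamily d Ω m u D) :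
    ∀ α ∈ multiIdx d m, AEStronglyMeasurable (D α) (volume.restrict Ω) := 
  fun α hα => (hD α hα).2.1.aestronglyMeasurable

lemma knormP_eq {ρ : Ed d → ℝ} {Ω : Set (Ed d)} (h : GoodW ρ Ω) (p : ℝ≥0) (m : ℕ) (a : ℝ) 
    {D : (Fin d → ℕ) → Ed d → ℝ} 
    (hD : ∀ α ∈ multiIdx d m, AEStronglyMeasurable (D α) (volume.restrict Ω)) 
    (hfin : ∀ α ∈ multiIdx d m, ∫⁻ x in Ω, kE ρ p a (ord α) (D α) x ≠ ⊤) :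
    KnormP d Ω ρ m a p D = (∫⁻ x in Ω, gS ρ p m a D x).toReal ^ (1 / (p : ℝ)) := by
  unfold KnormP
  rw [lint_gS h p m a hD, ENNReal.toReal_sum hfin]
  congr 1
  exact Finset.sum_congr rfl fun α hα => kInt_integral h p a α (hD α hα)

lemma kE_prodFam (ρ : Ed d → ℝ) (p : ℝ≥0) (hp : 1 ≤ p) (a : ℝ) (α : Fin d → ℕ) : 
    ∃ C : ℝ≥0, ∀ (D E : (Fin d → ℕ) → Ed d → ℝ) (x : Ed d), 
      kE ρ p a (ord α) (prodFam D E α) x ≤ 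
        C * ∑ q ∈ splits α, kE ρ p a (ord q.1 + ord q.2) (D q.1 * E q.2) x := by
  set L : ℝ≥0 := ∑ q ∈ splits α, ‖lc α q‖₊ with hL
  have hpr : (0 : ℝ) ≤ p := p.2
  have hpr1 : (1 : ℝ) ≤ p := by exact_mod_cast hp
  refine ⟨L ^ (p : ℝ) * ((splits α).card : ℝ≥0) ^ ((p : ℝ) - 1), fun D E x => ?_⟩
  have hb : ‖prodFam D E α x‖ₑ ≤ L * ∑ q ∈ splits α, ‖(D q.1 * E q.2) x‖ₑ := by
    unfold prodFam
    rw [Finset.sum_apply]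
    refine (enorm_sum_le _ _).trans ?_
    rw [Finset.mul_sum]
    refine Finset.sum_le_sum fun q hq => ?_
    rw [Pi.smul_apply, enorm_smul]
    gcongr
    rw [enorm_eq_nnnorm]
    exact_mod_cast Finset.single_le_sum (f := fun q => ‖lc α q‖₊) (fun _ _ => zero_le) hq
  unfold kE
  set w := ENNReal.ofReal (ρ x ^ ((ord α : ℝ) - a)) with hw
  calc (w * ‖prodFam D E α x‖ₑ) ^ (p : ℝ) 
      ≤ (L * ∑ q ∈ splits α, w * ‖(D q.1 * E q.2) x‖ₑ) ^ (p : ℝ) := by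
        apply ENNReal.rpow_le_rpow _ hpr
        rw [← Finset.mul_sum, mul_left_comm]
        gcongr
    _ ≤ (L : ℝ≥0∞) ^ (p : ℝ) * (((splits α).card : ℝ≥0∞) ^ ((p : ℝ) - 1) * 
          ∑ q ∈ splits α, (w * ‖(D q.1 * E q.2) x‖ₑ) ^ (p : ℝ)) := by
        rw [ENNReal.mul_rpow_of_nonneg _ _ hpr]
        gcongr
        exact ENNReal.rpow_sum_le_const_mul_sum_rpow _ _ hpr1
    _ = _ := by
        rw [← mul_assoc, ENNReal.coe_mul, ENNReal.coe_rpow_of_nonneg _ hpr, 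
          ENNReal.coe_rpow_of_nonneg _ (by linarith)]
        push_cast
        congr 1
        refine Finset.sum_congr rfl fun q hq => ?_
        have : ord α = ord q.1 + ord q.2 := by rw [← mem_splits.mp hq, ord_add]
        rw [hw, this]
        push_cast
        rfl

lemma prodest (hd : 2 ≤ d) (m : ℕ) (p : ℝ≥0) (hp : 1 ≤ p) (halg : AlgCond d m p)
    {ρ : Ed d → ℝ} {Ω : Set (Ed d)} (h : GoodW ρ Ω) (a₁ a₂ : ℝ) : ∃ C : ℝ≥0, 
    ∀ (D E : (Fin d → ℕ) → Ed d → ℝ), 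
      (∀ α ∈ multiIdx d m, AEStronglyMeasurable (D α) (volume.restrict Ω)) → 
      (∀ α ∈ multiIdx d m, AEStronglyMeasurable (E α) (volume.restrict Ω)) → 
      (∀ K ⊆ Ω, IsCompact K → ∃ u, ApproxBy p m K D u) → 
      (∀ K ⊆ Ω, IsCompact K → ∃ v, ApproxBy p m K E v) → 
      ∫⁻ x in Ω, gS ρ p m a₂ E x ≠ ⊤ → 
      ∑ α ∈ multiIdx d m, ∫⁻ x in Ω, kE ρ p (a₁ + a₂ - d / p) (ord α) (prodFam D E α) x ≤ 
        C * ((∫⁻ x in Ω, gS ρ p m a₁ D x) * (∫⁻ x in Ω, gS ρ p m a₂ E x)) := by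
  have hex : ∀ q : (Fin d → ℕ) × (Fin d → ℕ), ∃ C : ℝ≥0, ord q.1 + ord q.2 ≤ m → 
    ∀ (D E : (Fin d → ℕ) → Ed d → ℝ), 
      (∀ α ∈ multiIdx d m, AEStronglyMeasurable (D α) (volume.restrict Ω)) → 
      (∀ α ∈ multiIdx d m, AEStronglyMeasurable (E α) (volume.restrict Ω)) → 
      (∀ K ⊆ Ω, IsCompact K → ∃ u, ApproxBy p m K D u) → 
      (∀ K ⊆ Ω, IsCompact K → ∃ v, ApproxBy p m K E v) → 
      ∫⁻ x in Ω, gS ρ p m a₂ E x ≠ ⊤ → 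
      ∫⁻ x in Ω, kE ρ p (a₁ + a₂ - d / p) (ord q.1 + ord q.2) (D q.1 * E q.2) x ≤ 
        C * ((∫⁻ x in Ω, gS ρ p m a₁ D x) * (∫⁻ x in Ω, gS ρ p m a₂ E x)) := by
    intro q
    by_cases hq : ord q.1 + ord q.2 ≤ m
    · obtain ⟨C, hC⟩ := globest hd m p hp halg h a₁ a₂ q.1 q.2 hq
      exact ⟨C, fun _ => hC⟩
    · exact ⟨0, fun hh => absurd hh hq⟩
  choose G hG using hex
  choose F hF using fun α => kE_prodFam ρ p hp (a₁ + a₂ - d / p) (d := d) α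
  refine ⟨∑ α ∈ multiIdx d m, F α * ∑ q ∈ splits α, G q, fun D E hDm hEm hDa hEa hfin => ?_⟩
  set Z := (∫⁻ x in Ω, gS ρ p m a₁ D x) * (∫⁻ x in Ω, gS ρ p m a₂ E x) with hZ
  push_cast
  rw [Finset.sum_mul]
  refine Finset.sum_le_sum fun α hα => ?_
  have hαm := mem_multiIdx.mp hα
  have hord : ∀ q ∈ splits α, ord q.1 + ord q.2 ≤ m := by
    intro q hq
    have : ord α = ord q.1 + ord q.2 := by rw [← mem_splits.mp hq, ord_add]
    omega
  calc ∫⁻ x in Ω, kE ρ p (a₁ + a₂ - d / p) (ord α) (prodFam D E α) x 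
      ≤ ∫⁻ x in Ω, F α * ∑ q ∈ splits α, 
          kE ρ p (a₁ + a₂ - d / p) (ord q.1 + ord q.2) (D q.1 * E q.2) x := 
        lintegral_mono fun x => hF α D E x
    _ = F α * ∑ q ∈ splits α, 
          ∫⁻ x in Ω, kE ρ p (a₁ + a₂ - d / p) (ord q.1 + ord q.2) (D q.1 * E q.2) x := by
        rw [lintegral_const_mul' _ _ ENNReal.coe_ne_top, lintegral_finsetSum']
        intro q hq
        have := hord q hq
        exact kE_aemeas h p _ _ ((hDm q.1 (mem_multiIdx.mpr (by omega))).mul 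
          (hEm q.2 (mem_multiIdx.mpr (by omega))))
    _ ≤ F α * ∑ q ∈ splits α, G q * Z := by
        gcongr with q hq
        exact hG q (hord q hq) D E hDm hEm hDa hEa hfin
    _ = _ := by rw [← Finset.sum_mul, mul_assoc]

lemma data_of {ρ : Ed d → ℝ} {Ω : Set (Ed d)} (h : GoodW ρ Ω) (p : ℝ≥0) (hp : 1 ≤ p) {m m' : ℕ} 
    (hm : m ≤ m') (a : ℝ) {u : Ed d → ℝ} {D : (Fin d → ℕ) → Ed d → ℝ} 
    (hD : KMemData d Ω ρ m' a p u D) :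
    IsWeakDerivFamily d Ω m u D ∧ 
    (∀ α ∈ multiIdx d m, AEStronglyMeasurable (D α) (volume.restrict Ω)) ∧ 
    (∀ α ∈ multiIdx d m, ∀ K' ⊆ Ω, IsCompact K' → MemLp (D α) p (volume.restrict K')) ∧ 
    ∫⁻ x in Ω, gS ρ p m' a D x ≠ ⊤ ∧ 
    ∫⁻ x in Ω, gS ρ p m a D x ≤ ∫⁻ x in Ω, gS ρ p m' a D x ∧ 
    KnormP d Ω ρ m' a p D = (∫⁻ x in Ω, gS ρ p m' a D x).toReal ^ (1 / (p : ℝ)) := by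
  have hsub : ∀ α ∈ multiIdx d m, α ∈ multiIdx d m' := fun α hα => 
    mem_multiIdx.mpr ((mem_multiIdx.mp hα).trans hm)
  have hae' := fam_aesm h.isOpen hD.1
  have hfin : ∀ α ∈ multiIdx d m', ∫⁻ x in Ω, kE ρ p a (ord α) (D α) x ≠ ⊤ := fun α hα => 
    (kInt_integrable h p a α (hae' α hα)).mp (hD.2 α hα)
  refine ⟨fun α hα => hD.1 α (hsub α hα), fun α hα => hae' α (hsub α hα), 
    fun α hα K hKΩ hK => memLp_loc h p hp a (ord α) (hae' α (hsub α hα)) (hfin α (hsub α hα)) hKΩ hK,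
    ?_, ?_, knormP_eq h p m' a hae' hfin⟩
  · rw [lint_gS h p m' a hae']
    exact (ENNReal.sum_lt_top.mpr fun α hα => (hfin α hα).lt_top).ne
  · apply lintegral_mono
    intro x
    exact Finset.sum_le_sum_of_subset hsub

lemma final_nn (hd : 2 ≤ d) (m m₁ m₂ : ℕ) (h1 : m ≤ m₁) (h2 : m ≤ m₂) (p : ℝ≥0) (hp : 1 ≤ p) 
    (halg : AlgCond d m p)
    {ρ : Ed d → ℝ} {Ω : Set (Ed d)} (h : GoodW ρ Ω) (a₁ a₂ : ℝ) : ∃ c : ℝ, 0 < c ∧ 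
    ∀ u v : Ed d → ℝ, MemK d Ω ρ m₁ a₁ p u → MemK d Ω ρ m₂ a₂ p v → 
      MemK d Ω ρ m (a₁ + a₂ - d / p) p (u * v) ∧
      Knorm d Ω ρ m (a₁ + a₂ - d / p) p (u * v) ≤
        c * Knorm d Ω ρ m₁ a₁ p u * Knorm d Ω ρ m₂ a₂ p v := by
  obtain ⟨C, hC⟩ := prodest hd m p hp halg h a₁ a₂
  refine ⟨(C : ℝ) ^ (1 / (p : ℝ)) + 1, by positivity, fun u v hu hv => ?_⟩
  obtain ⟨uF, uM, uL, ufin, ule, ueq⟩ := data_of h p hp h1 a₁ hu.choose_spec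
  obtain ⟨vF, vM, vL, vfin, vle, veq⟩ := data_of h p hp h2 a₂ hv.choose_spec
  set D := hu.choose with hDdef
  set E := hv.choose with hEdef
  set b := a₁ + a₂ - d / p with hb
  have hΩ := h.isOpen
  have hW := weak_prod hd m p hp halg hΩ uF vF uL vL
  have hWm := fam_aesm hΩ hW
  have est := hC D E uM vM (fun K hK hKc => approx_exists p hp hΩ hKc hK uF uL) 
    (fun K hK hKc => approx_exists p hp hΩ hKc hK vF vL) (ne_top_of_le_ne_top vfin vle)
  have est2 : ∑ α ∈ multiIdx d m, ∫⁻ x in Ω, kE ρ p b (ord α) (prodFam D E α) x ≤ 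
      C * ((∫⁻ x in Ω, gS ρ p m₁ a₁ D x) * (∫⁻ x in Ω, gS ρ p m₂ a₂ E x)) := 
    est.trans (by gcongr)
  have htop : (C : ℝ≥0∞) * ((∫⁻ x in Ω, gS ρ p m₁ a₁ D x) * (∫⁻ x in Ω, gS ρ p m₂ a₂ E x)) ≠ ⊤ := 
    ENNReal.mul_ne_top ENNReal.coe_ne_top (ENNReal.mul_ne_top ufin vfin)
  have hfin : ∀ α ∈ multiIdx d m, ∫⁻ x in Ω, kE ρ p b (ord α) (prodFam D E α) x ≠ ⊤ := by
    intro α hα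
    exact (ENNReal.sum_lt_top.mp ((est2.trans_lt htop.lt_top)) α hα).ne
  have hmem : MemK d Ω ρ m b p (u * v) := 
    ⟨prodFam D E, hW, fun α hα => (kInt_integrable h p b α (hWm α hα)).mpr (hfin α hα)⟩
  refine ⟨hmem, ?_⟩
  have eq1 : Knorm d Ω ρ m b p (u * v) = KnormP d Ω ρ m b p (prodFam D E) := by
    unfold Knorm
    rw [dif_pos hmem]
    unfold KnormP
    congr 1
    refine Finset.sum_congr rfl fun α hα => integral_congr_ae ?_
    have hun := weak_unique hΩ (hmem.choose_spec.1 α hα) (hW α hα)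
    filter_upwards [hun] with x hx
    unfold kIntegrand
    rw [hx]
  have eq2 : Knorm d Ω ρ m₁ a₁ p u = KnormP d Ω ρ m₁ a₁ p D := by
    unfold Knorm
    rw [dif_pos hu]
  have eq3 : Knorm d Ω ρ m₂ a₂ p v = KnormP d Ω ρ m₂ a₂ p E := by
    unfold Knorm
    rw [dif_pos hv]
  rw [eq1, eq2, eq3, ueq, veq, knormP_eq h p m b hWm hfin, lint_gS h p m b hWm]
  have hr := ENNReal.toReal_mono htop est2
  rw [ENNReal.toReal_mul, ENNReal.toReal_mul, ENNReal.coe_toReal] at hr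
  set A := (∫⁻ x in Ω, gS ρ p m₁ a₁ D x).toReal
  set B := (∫⁻ x in Ω, gS ρ p m₂ a₂ E x).toReal
  have hA : 0 ≤ A := ENNReal.toReal_nonneg
  have hB : 0 ≤ B := ENNReal.toReal_nonneg
  calc _ ≤ ((C : ℝ) * (A * B)) ^ (1 / (p : ℝ)) := 
        Real.rpow_le_rpow ENNReal.toReal_nonneg hr (by positivity)
    _ = (C : ℝ) ^ (1 / (p : ℝ)) * A ^ (1 / (p : ℝ)) * B ^ (1 / (p : ℝ)) := by
        rw [Real.mul_rpow C.coe_nonneg (by positivity), Real.mul_rpow hA hB, mul_assoc]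
    _ ≤ _ := by
        gcongr
        linarith

end Final
/-- Corollary `lem-mult1`: if either `1 < p < ∞` and `min(m₁,m₂) ≥ m > d/p`, or `p = 1`
and `min(m₁,m₂) ≥ m ≥ d`, then
`‖u·v|𝒦^m_{a₁+a₂-d/p,p}‖ ≤ c ‖u|𝒦^{m₁}_{a₁,p}‖ ‖v|𝒦^{m₂}_{a₂,p}‖` in the model case. -/
theorem statement12 (d ℓ m m₁ m₂ : ℕ) (hd : 2 ≤ d) (hl : ℓ < d)
    (a₁ a₂ p : ℝ) (hp : 1 ≤ p)
    (halg : (1 < p ∧ m ≤ min m₁ m₂ ∧ (d : ℝ) / p < m) ∨ (p = 1 ∧ m ≤ min m₁ m₂ ∧ d ≤ m)) :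
    ∃ c : ℝ, 0 < c ∧ ∀ u v : Ed d → ℝ,
      MemKM d ℓ m₁ a₁ p u → MemKM d ℓ m₂ a₂ p v →
      MemKM d ℓ m (a₁ + a₂ - d / p) p (u * v) ∧
      KnormM d ℓ m (a₁ + a₂ - d / p) p (u * v) ≤
        c * KnormM d ℓ m₁ a₁ p u * KnormM d ℓ m₂ a₂ p v := by
  have hl' : m ≤ m₁ ∧ m ≤ m₂ := by
    rcases halg with h | h
    · exact le_min_iff.mp h.2.1
    · exact le_min_iff.mp h.2.1
  have hp0 : 0 ≤ p := by linarith
  have hcond : AlgCond d m ⟨p, hp0⟩ := by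
    rcases halg with h | h
    · exact Or.inl ⟨h.1, h.2.2⟩
    · exact Or.inr ⟨NNReal.eq h.1, h.2.2⟩
  exact final_nn hd m m₁ m₂ hl'.1 hl'.2 ⟨p, hp0⟩ hp hcond (goodW_model ℓ hl) a₁ a₂

end
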